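/- Let γ ∈ ℝ with γ ≠ 0 and |γ| ≠ 1, let b, b₁, c₁ ∈ (1/4, 1/2) satisfy b + b₁ + c₁ ≥ 1, and let s ≥ 0. Then there exists a constant C > 0 such that for all nonnegative measurable functions F, G : ℝ² → [0,∞): ‖ ⟨ξ⟩^{s} ⟨τ+ξ²⟩^{−c₁} (F∗G)(τ,ξ) ‖_{L²_{τ,ξ}} ≤ C ( ‖⟨ξ⟩^{s−1/2}⟨τ+γ|ξ|ξ⟩^{b} F‖_{L²_{τ,ξ}} · ‖⟨τ+ξ²⟩^{b₁} G‖_{L²_{τ,ξ}} + ‖⟨ξ⟩^{−1/2}⟨τ+γ|ξ|ξ⟩^{b} F‖_{L²_{τ,ξ}} · ‖⟨ξ⟩^{s}⟨τ+ξ²⟩^{b₁} G‖_{L²_{τ,ξ}} ), where (F∗G)(τ,ξ) = ∫_{ℝ²} F(τ₁,ξ₁) G(τ−τ₁, ξ−ξ₁) dτ₁ dξ₁. (This is the Fourier-side formulation of the bilinear estimate ‖uv‖_{X^{s,−c₁}} ≲ ‖u‖_{Y_γ^{s−1/2,b}}‖v‖_{X^{0,b₁}} + ‖u‖_{Y_γ^{−1/2,b}}‖v‖_{X^{s,b₁}},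 with F = û and G = v̂.) -/

import Mathlib

open MeasureTheory ENNReal

/-- Japanese bracket `⟨x⟩ = 1 + |x|`. -/
noncomputable def jb (x : ℝ) : ℝ := 1 + |x|

/-- Convolution of two nonnegative functions on `ℝ²`, valued in `ℝ≥0∞`. -/
noncomputable def convR2 (F G : ℝ × ℝ → ℝ) (p : ℝ × ℝ) : ℝ≥0∞ :=
  ∫⁻ q : ℝ × ℝ, ENNReal.ofReal (F q * G (p - q))

/-- The `L²` norm (valued in `ℝ≥0∞`) of a nonnegative function on `ℝ²`. -/
noncomputable def l2R2 (f : ℝ × ℝ → ℝ) : ℝ≥0∞ :=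
  (∫⁻ p : ℝ × ℝ, ENNReal.ofReal (f p) ^ 2) ^ (1/2 : ℝ)


/-- `L²` norm of an `ℝ≥0∞`-valued function. -/
noncomputable def nrm (f : ℝ × ℝ → ℝ≥0∞) : ℝ≥0∞ := (∫⁻ p, f p ^ 2) ^ (1/2 : ℝ)

lemma nrm_sq (f : ℝ × ℝ → ℝ≥0∞) : (nrm f) ^ 2 = ∫⁻ p, f p ^ 2 := by
  unfold nrm
  rw [← ENNReal.rpow_natCast, ← ENNReal.rpow_mul]; norm_num

lemma sq_rpow_half (a : ℝ≥0∞) : (a ^ 2) ^ (1/2 : ℝ) = a := by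
  rw [← ENNReal.rpow_natCast, ← ENNReal.rpow_mul]; norm_num

/-- Cauchy-Schwarz on the product space. -/
lemma cs_prod (u v : (ℝ × ℝ) × (ℝ × ℝ) → ℝ≥0∞) (hu : Measurable u) (hv : Measurable v) :
    ∫⁻ p, ∫⁻ q, u (p, q) * v (p, q) ≤
      (∫⁻ p, ∫⁻ q, u (p, q) ^ 2) ^ (1/2 : ℝ) * (∫⁻ p, ∫⁻ q, v (p, q) ^ 2) ^ (1/2 : ℝ) := by
  have h := ENNReal.lintegral_mul_le_Lp_mul_Lq
    ((volume : Measure (ℝ × ℝ)).prod (volume : Measure (ℝ × ℝ)))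
    (p := 2) (q := 2) (by constructor <;> norm_num) hu.aemeasurable hv.aemeasurable
  simp only [Pi.mul_apply] at h
  rw [lintegral_prod _ (by fun_prop), lintegral_prod _ (by fun_prop),
    lintegral_prod _ (by fun_prop)] at h
  simpa using h

lemma cs_p (κ : (ℝ × ℝ) × (ℝ × ℝ) → ℝ≥0∞) (hκ : Measurable κ) (A : ℝ≥0∞)
    (hA : ∀ p, ∫⁻ q, κ (p, q) ^ 2 ≤ A ^ 2)
    (f g h : ℝ × ℝ → ℝ≥0∞) (hf : Measurable f) (hg : Measurable g) (hh : Measurable h) :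
    ∫⁻ p, ∫⁻ q, κ (p, q) * f q * g (p - q) * h p ≤ A * nrm f * nrm g * nrm h := by
  have h1 := cs_prod (fun z => κ z * h z.1) (fun z => f z.2 * g (z.1 - z.2))
    (by fun_prop) (by fun_prop)
  have e2 : ∫⁻ p, ∫⁻ q, (f q * g (p - q)) ^ 2 = (nrm f * nrm g) ^ 2 := by
    rw [lintegral_lintegral_swap (by fun_prop)]
    simp_rw [mul_pow]
    have : ∀ q : ℝ × ℝ, ∫⁻ p, f q ^ 2 * g (p - q) ^ 2 = f q ^ 2 * nrm g ^ 2 := by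
      intro q
      rw [lintegral_const_mul _ (by fun_prop), lintegral_sub_right_eq_self (fun p => g p ^ 2) q,
        nrm_sq]
    simp_rw [this]
    rw [lintegral_mul_const _ (by fun_prop), nrm_sq f]
  have e1 : ∫⁻ p, ∫⁻ q, (κ (p, q) * h p) ^ 2 ≤ (A * nrm h) ^ 2 := by
    simp_rw [mul_pow, nrm_sq h]
    rw [← lintegral_const_mul _ (by fun_prop)]
    refine lintegral_mono fun p => ?_
    dsimp only
    rw [lintegral_mul_const _ (by fun_prop)]
    gcongr
    exact hA p
  calc _ = ∫⁻ p, ∫⁻ q, κ (p, q) * h p * (f q * g (p - q)) := by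
        congr 1; ext p; congr 1; ext q; ring
    _ ≤ _ := h1
    _ ≤ ((A * nrm h) ^ 2) ^ (1/2 : ℝ) * ((nrm f * nrm g) ^ 2) ^ (1/2 : ℝ) := by
        simp only at e1 e2 ⊢
        rw [e2]; gcongr
    _ = _ := by rw [sq_rpow_half, sq_rpow_half]; ring

lemma cs_q (κ : (ℝ × ℝ) × (ℝ × ℝ) → ℝ≥0∞) (hκ : Measurable κ) (A : ℝ≥0∞)
    (hA : ∀ q, ∫⁻ p, κ (p, q) ^ 2 ≤ A ^ 2)
    (f g h : ℝ × ℝ → ℝ≥0∞) (hf : Measurable f) (hg : Measurable g) (hh : Measurable h) :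
    ∫⁻ p, ∫⁻ q, κ (p, q) * f q * g (p - q) * h p ≤ A * nrm f * nrm g * nrm h := by
  have h1 := cs_prod (fun z => κ z * f z.2) (fun z => h z.1 * g (z.1 - z.2))
    (by fun_prop) (by fun_prop)
  have e2 : ∫⁻ p, ∫⁻ q, (h p * g (p - q)) ^ 2 = (nrm h * nrm g) ^ 2 := by
    simp_rw [mul_pow]
    have : ∀ p : ℝ × ℝ, ∫⁻ q, h p ^ 2 * g (p - q) ^ 2 = h p ^ 2 * nrm g ^ 2 := by
      intro p
      rw [lintegral_const_mul _ (by fun_prop), lintegral_sub_left_eq_self (fun p => g p ^ 2) p,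
        nrm_sq]
    simp_rw [this]
    rw [lintegral_mul_const _ (by fun_prop), nrm_sq h]
  have e1 : ∫⁻ p, ∫⁻ q, (κ (p, q) * f q) ^ 2 ≤ (A * nrm f) ^ 2 := by
    rw [lintegral_lintegral_swap (by fun_prop)]
    simp_rw [mul_pow, nrm_sq f]
    rw [← lintegral_const_mul _ (by fun_prop)]
    refine lintegral_mono fun p => ?_
    dsimp only
    rw [lintegral_mul_const _ (by fun_prop)]
    gcongr
    exact hA p
  calc _ = ∫⁻ p, ∫⁻ q, κ (p, q) * f q * (h p * g (p - q)) := by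
        congr 1; ext p; congr 1; ext q; ring
    _ ≤ _ := h1
    _ ≤ ((A * nrm f) ^ 2) ^ (1/2 : ℝ) * ((nrm h * nrm g) ^ 2) ^ (1/2 : ℝ) := by
        simp only at e1 e2 ⊢
        rw [e2]; gcongr
    _ = _ := by rw [sq_rpow_half, sq_rpow_half]; ring

lemma cs_r (κ : (ℝ × ℝ) × (ℝ × ℝ) → ℝ≥0∞) (hκ : Measurable κ) (A : ℝ≥0∞)
    (hA : ∀ r, ∫⁻ q, κ (r + q, q) ^ 2 ≤ A ^ 2)
    (f g h : ℝ × ℝ → ℝ≥0∞) (hf : Measurable f) (hg : Measurable g) (hh : Measurable h) :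
    ∫⁻ p, ∫⁻ q, κ (p, q) * f q * g (p - q) * h p ≤ A * nrm f * nrm g * nrm h := by
  have h1 := cs_prod (fun z => κ z * g (z.1 - z.2)) (fun z => h z.1 * f z.2)
    (by fun_prop) (by fun_prop)
  have e2 : ∫⁻ p, ∫⁻ q, (h p * f q) ^ 2 = (nrm h * nrm f) ^ 2 := by
    simp_rw [mul_pow]
    have : ∀ p : ℝ × ℝ, ∫⁻ q, h p ^ 2 * f q ^ 2 = h p ^ 2 * nrm f ^ 2 := by
      intro p
      rw [lintegral_const_mul _ (by fun_prop), nrm_sq]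
    simp_rw [this]
    rw [lintegral_mul_const _ (by fun_prop), nrm_sq h]
  have e1 : ∫⁻ p, ∫⁻ q, (κ (p, q) * g (p - q)) ^ 2 ≤ (A * nrm g) ^ 2 := by
    rw [lintegral_lintegral_swap (by fun_prop)]
    have : ∀ q : ℝ × ℝ, ∫⁻ p, (κ (p, q) * g (p - q)) ^ 2 = ∫⁻ r, (κ (r + q, q) * g r) ^ 2 := by
      intro q
      rw [← lintegral_add_right_eq_self _ q]
      simp
    simp_rw [this]
    rw [lintegral_lintegral_swap (by fun_prop)]
    simp_rw [mul_pow, nrm_sq g]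
    rw [← lintegral_const_mul _ (by fun_prop)]
    refine lintegral_mono fun p => ?_
    dsimp only
    rw [lintegral_mul_const _ (by fun_prop)]
    gcongr
    exact hA p
  calc _ = ∫⁻ p, ∫⁻ q, κ (p, q) * g (p - q) * (h p * f q) := by
        congr 1; ext p; congr 1; ext q; ring
    _ ≤ _ := h1
    _ ≤ ((A * nrm g) ^ 2) ^ (1/2 : ℝ) * ((nrm h * nrm f) ^ 2) ^ (1/2 : ℝ) := by
        simp only at e1 e2 ⊢
        rw [e2]; gcongr
    _ = _ := by rw [sq_rpow_half, sq_rpow_half]; ring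

/-- Duality. -/
lemma nrm_le_of_dual (u : ℝ × ℝ → ℝ≥0∞) (hu : Measurable u) (B : ℝ≥0∞)
    (H : ∀ h : ℝ × ℝ → ℝ≥0∞, Measurable h → ∫⁻ p, u p * h p ≤ B * nrm h) : nrm u ≤ B := by
  have key : ∫⁻ p, u p ^ 2 ≤ B ^ 2 := by
    by_contra! hc
    rw [lintegral_eq_nnreal] at hc
    simp_rw [lt_iSup_iff] at hc
    obtain ⟨φ₀, hφ₀le, hφ₀⟩ := hc
    rw [← SimpleFunc.lintegral_eq_lintegral] at hφ₀
    obtain ⟨φ, hφle, hφfin, hφ⟩ := exists_lt_lintegral_simpleFunc_of_lt_lintegral (f := φ₀) (by simpa using hφ₀)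
    have hle : ∀ p, (φ p : ℝ≥0∞) ≤ u p ^ 2 := fun p =>
      (ENNReal.coe_le_coe.2 (hφle p)).trans (hφ₀le p)
    set h : ℝ × ℝ → ℝ≥0∞ := fun p => (φ p : ℝ≥0∞) ^ (1/2 : ℝ) with hh
    have hm : Measurable h := by
      have := φ.measurable
      fun_prop
    have hsq : ∀ p, h p ^ 2 = φ p := by
      intro p
      simp only [hh]
      rw [← ENNReal.rpow_natCast, ← ENNReal.rpow_mul]; norm_num
    have hlu : ∀ p, h p ≤ u p := by
      intro p
      calc h p ≤ (u p ^ 2) ^ (1/2 : ℝ) := by simp only [hh]; gcongr; exact hle p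
        _ = u p := sq_rpow_half _
    have hn : nrm h ^ 2 = ∫⁻ p, (φ p : ℝ≥0∞) := by rw [nrm_sq]; simp_rw [hsq]
    have h1 : nrm h ^ 2 ≤ B * nrm h := by
      rw [nrm_sq]
      refine le_trans (lintegral_mono fun p => ?_) (H h hm)
      rw [sq]; gcongr; exact hlu p
    have hfin : nrm h ≠ ∞ := by
      intro hi; rw [hi] at hn; simp at hn; rw [← hn] at hφfin; exact lt_irrefl _ hφfin
    rw [← hn] at hφ
    have h0 : nrm h ≠ 0 := by
      intro hi; rw [hi] at hφ; simp at hφ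
    have h2 : nrm h ≤ B := by
      rw [sq] at h1
      exact (ENNReal.mul_le_mul_iff_left h0 hfin).1 h1
    exact absurd hφ (not_lt.2 (by gcongr))
  calc nrm u ≤ (B ^ 2) ^ (1/2 : ℝ) := by unfold nrm; gcongr
    _ = B := sq_rpow_half B

lemma jb_ge_one (x : ℝ) : 1 ≤ jb x := by unfold jb; linarith [abs_nonneg x]
lemma jb_pos (x : ℝ) : 0 < jb x := lt_of_lt_of_le one_pos (jb_ge_one x)
@[fun_prop] lemma continuous_jb : Continuous jb := by unfold jb; fun_prop
@[fun_prop] lemma measurable_jb : Measurable jb := continuous_jb.measurable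
lemma jb_neg (x : ℝ) : jb (-x) = jb x := by simp [jb]

lemma int_jb_half (β : ℝ) (hβ : β < 1) (L : ℝ) (hL : 0 ≤ L) :
    ∫⁻ x in Set.Icc 0 L, ENNReal.ofReal (jb x ^ (-β)) ≤
      ENNReal.ofReal ((1 / (1 - β)) * (1 + L) ^ (1 - β)) := by
  have hIntg : IntervalIntegrable (fun x : ℝ => jb x ^ (-β)) volume 0 L := by
    apply Continuous.intervalIntegrable
    exact continuous_jb.rpow_const (fun x => Or.inl (jb_pos x).ne')
  rw [MeasureTheory.restrict_Ioc_eq_restrict_Icc.symm]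
  rw [← ofReal_integral_eq_lintegral_ofReal, ← intervalIntegral.integral_of_le hL]
  · apply ENNReal.ofReal_le_ofReal
    have : ∫ x in (0:ℝ)..L, jb x ^ (-β) = ∫ x in (0:ℝ)..L, (x + 1) ^ (-β) := by
      apply intervalIntegral.integral_congr
      intro x hx
      rw [Set.uIcc_of_le hL] at hx
      simp only [jb, abs_of_nonneg hx.1, add_comm]
    rw [this, intervalIntegral.integral_comp_add_right (fun x : ℝ => x ^ (-β)),
      integral_rpow (Or.inl (by linarith))]
    have h1 : (0:ℝ) < 1 - β := by linarith
    rw [show -β + 1 = 1 - β by ring, div_eq_mul_one_div, mul_comm]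
    gcongr
    rw [add_comm L 1]
    have : (0:ℝ) ≤ (0+1:ℝ)^(1-β) := by positivity
    linarith
  · exact (intervalIntegrable_iff_integrableOn_Ioc_of_le hL).1 hIntg
  · filter_upwards with x
    exact Real.rpow_nonneg (jb_pos x).le _

lemma int_jb_ball (β : ℝ) (hβ : β < 1) (L : ℝ) (hL : 0 ≤ L) :
    ∫⁻ x in Set.Icc (-L) L, ENNReal.ofReal (jb x ^ (-β)) ≤
      ENNReal.ofReal ((2 / (1 - β)) * (1 + L) ^ (1 - β)) := by
  have h0 := int_jb_half β hβ L hL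
  have h1 : ∫⁻ x in Set.Icc (-L) 0, ENNReal.ofReal (jb x ^ (-β)) =
      ∫⁻ x in Set.Icc 0 L, ENNReal.ofReal (jb x ^ (-β)) := by
    rw [← lintegral_indicator measurableSet_Icc, ← lintegral_indicator measurableSet_Icc,
      ← lintegral_neg_eq_self]
    congr 1; ext x
    simp only [Set.indicator, Set.mem_Icc, jb_neg]
    congr 1
    apply propext; constructor <;> rintro ⟨a, b⟩ <;> constructor <;> linarith
  have hs : Set.Icc (-L) L ⊆ Set.Icc (-L) 0 ∪ Set.Icc 0 L := by
    intro x hx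
    rcases le_total x 0 with h | h
    · left; exact ⟨hx.1, h⟩
    · right; exact ⟨h, hx.2⟩
  have h2 : (0:ℝ) < 1 - β := by linarith
  calc _ ≤ ∫⁻ x in Set.Icc (-L) 0 ∪ Set.Icc 0 L, ENNReal.ofReal (jb x ^ (-β)) :=
        lintegral_mono_set hs
    _ ≤ _ := lintegral_union_le _ _ _
    _ ≤ ENNReal.ofReal ((1 / (1 - β)) * (1 + L) ^ (1 - β)) +
        ENNReal.ofReal ((1 / (1 - β)) * (1 + L) ^ (1 - β)) := by rw [h1]; gcongr
    _ = _ := by rw [← ENNReal.ofReal_add (by positivity) (by positivity)]; congr 1; ring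

lemma int_jb_shift (β : ℝ) (hβ0 : 0 ≤ β) (hβ : β < 1) (c k L : ℝ) (hL : 0 ≤ L) :
    ∫⁻ x in Set.Icc (c - L) (c + L), ENNReal.ofReal (jb (x - k) ^ (-β)) ≤
      ENNReal.ofReal ((2 / (1 - β) + 2) * (1 + L) ^ (1 - β)) := by
  have h2 : (0:ℝ) < 1 - β := by linarith
  have hA : ∫⁻ x in Set.Icc (k - L) (k + L), ENNReal.ofReal (jb (x - k) ^ (-β)) ≤
      ENNReal.ofReal ((2 / (1 - β)) * (1 + L) ^ (1 - β)) := by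
    refine le_trans (le_of_eq ?_) (int_jb_ball β hβ L hL)
    rw [← lintegral_indicator measurableSet_Icc, ← lintegral_indicator measurableSet_Icc,
      ← lintegral_sub_right_eq_self ((Set.Icc (-L) L).indicator _) k]
    congr 1; ext x
    simp only [Set.indicator, Set.mem_Icc]
    congr 1
    apply propext; constructor <;> rintro ⟨a, b⟩ <;> constructor <;> linarith
  have hB : ∫⁻ x in Set.Icc (c - L) (c + L), ENNReal.ofReal ((1 + L) ^ (-β)) ≤
      ENNReal.ofReal (2 * (1 + L) ^ (1 - β)) := by
    rw [setLIntegral_const, Real.volume_Icc, ← ENNReal.ofReal_mul (by positivity)]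
    apply ENNReal.ofReal_le_ofReal
    rw [show (1:ℝ) - β = -β + 1 by ring, Real.rpow_add_one (by positivity)]
    have : 0 ≤ (1 + L) ^ (-β) := by positivity
    nlinarith
  calc _ ≤ ∫⁻ x, (Set.Icc (k - L) (k + L)).indicator
            (fun x => ENNReal.ofReal (jb (x - k) ^ (-β))) x +
          (Set.Icc (c - L) (c + L)).indicator (fun x => ENNReal.ofReal ((1 + L) ^ (-β))) x := by
        rw [← lintegral_indicator measurableSet_Icc]
        apply lintegral_mono
        intro x
        by_cases hx : x ∈ Set.Icc (c - L) (c + L)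
        · by_cases hy : x ∈ Set.Icc (k - L) (k + L)
          · simp [hx, hy]
          · simp only [Set.indicator_of_mem hx, Set.indicator_of_notMem hy, zero_add]
            apply ENNReal.ofReal_le_ofReal
            apply Real.rpow_le_rpow_of_nonpos (by positivity) _ (by linarith)
            unfold jb
            have : L ≤ |x - k| := by
              by_contra! h
              rw [abs_lt] at h
              exact hy ⟨by linarith, by linarith⟩
            linarith
        · simp [hx]
    _ ≤ _ := by
        rw [lintegral_add_right _ (by measurability), lintegral_indicator measurableSet_Icc,
          lintegral_indicator measurableSet_Icc]
    _ ≤ _ := add_le_add hA hB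
    _ = _ := by rw [← ENNReal.ofReal_add (by positivity) (by positivity)]; congr 1; ring

/-- Change of variables for a quadratic phase. -/
lemma int_quad (A x m : ℝ) (hA : A ≠ 0) (ψ : ℝ → ℝ≥0∞) :
    ∫⁻ y, ENNReal.ofReal |2 * A * y - 2 * x| * ψ (A * y ^ 2 - 2 * x * y + m) ≤
      2 * ∫⁻ u, ψ u := by
  have hd : ∀ y : ℝ, HasDerivAt (fun y => A * y ^ 2 - 2 * x * y + m) (2 * A * y - 2 * x) y := by
    intro y
    have := (((hasDerivAt_pow 2 y).const_mul A).sub ((hasDerivAt_id y).const_mul (2 * x))).add_const m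
    exact this.congr_deriv (by simp; ring)
  have inj : ∀ y z : ℝ, A * y ^ 2 - 2 * x * y + m = A * z ^ 2 - 2 * x * z + m →
      y = z ∨ A * (y + z) = 2 * x := by
    intro y z h
    have : (y - z) * (A * (y + z) - 2 * x) = 0 := by linear_combination h
    rcases mul_eq_zero.1 this with h | h
    · left; linarith
    · right; linarith
  have key : ∀ s : Set ℝ, MeasurableSet s →
      Set.InjOn (fun y => A * y ^ 2 - 2 * x * y + m) s →
      ∫⁻ y in s, ENNReal.ofReal |2 * A * y - 2 * x| * ψ (A * y ^ 2 - 2 * x * y + m) ≤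
        ∫⁻ u, ψ u := by
    intro s hs hi
    rw [← lintegral_image_eq_lintegral_abs_deriv_mul hs (fun y _ => (hd y).hasDerivWithinAt) hi]
    exact setLIntegral_le_lintegral _ _
  have hx : x = A * (x / A) := by field_simp
  have k1 := key (Set.Iic (x / A)) measurableSet_Iic (by
    intro y hy z hz h
    rcases inj y z h with h | h
    · exact h
    · have : y + z = 2 * (x / A) := by
        have := mul_left_cancel₀ hA (show A * (y + z) = A * (2 * (x / A)) by linarith)
        exact this
      simp only [Set.mem_Iic] at hy hz
      linarith)
  have k2 := key (Set.Ioi (x / A)) measurableSet_Ioi (by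
    intro y hy z hz h
    rcases inj y z h with h | h
    · exact h
    · have : y + z = 2 * (x / A) := by
        have := mul_left_cancel₀ hA (show A * (y + z) = A * (2 * (x / A)) by linarith)
        exact this
      simp only [Set.mem_Ioi] at hy hz
      linarith)
  rw [← setLIntegral_univ, ← Set.Iic_union_Ioi (a := x / A)]
  refine (lintegral_union_le _ _ _).trans ?_
  exact (add_le_add k1 k2).trans (two_mul _).ge

lemma int_lin (c m : ℝ) (hc : c ≠ 0) (ψ : ℝ → ℝ≥0∞) :
    ∫⁻ y, ENNReal.ofReal |c| * ψ (c * y + m) ≤ ∫⁻ u, ψ u := by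
  have hd : ∀ y : ℝ, HasDerivAt (fun y => c * y + m) c y := by
    intro y
    simpa using ((hasDerivAt_id y).const_mul c).add_const m
  have := lintegral_image_eq_lintegral_abs_deriv_mul (s := Set.univ) MeasurableSet.univ
    (fun y _ => (hd y).hasDerivWithinAt) (by
      intro y _ z _ h
      simpa [hc] using h) ψ
  rw [setLIntegral_univ] at this
  rw [← this]
  exact setLIntegral_le_lintegral _ _

lemma weight_aux (x y α β p q : ℝ) (hx : 1 ≤ x) (hxy : x ≤ y) (hsum : p + q = α + β)
    (hqβ : q ≤ β) : x ^ (-α) * y ^ (-β) ≤ x ^ (-p) * y ^ (-q) := by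
  have hx0 : 0 < x := by linarith
  have hy0 : 0 < y := by linarith
  have h1 : x ^ (-α) = x ^ (-p) * x ^ (β - q) := by
    rw [← Real.rpow_add hx0]; congr 1; linarith
  have h2 : y ^ (-q) = y ^ (-β) * y ^ (β - q) := by
    rw [← Real.rpow_add hy0]; congr 1; linarith
  have h3 : x ^ (β - q) ≤ y ^ (β - q) := Real.rpow_le_rpow hx0.le hxy (by linarith)
  rw [h1, h2]
  have : 0 ≤ x ^ (-p) * y ^ (-β) := by positivity
  nlinarith

lemma weight_split (x y α β p q : ℝ) (hx : 1 ≤ x) (hy : 1 ≤ y) (hsum : p + q = α + β)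
    (hqα : q ≤ α) (hqβ : q ≤ β) :
    x ^ (-α) * y ^ (-β) ≤ x ^ (-p) * y ^ (-q) + y ^ (-p) * x ^ (-q) := by
  have hx0 : 0 < x := by linarith
  have hy0 : 0 < y := by linarith
  rcases le_total x y with h | h
  · have := weight_aux x y α β p q hx h hsum hqβ
    have : 0 ≤ y ^ (-p) * x ^ (-q) := by positivity
    linarith
  · have := weight_aux y x β α p q hy h (by linarith) hqα
    have : 0 ≤ x ^ (-p) * y ^ (-q) := by positivity
    linarith [mul_comm (x ^ (-α)) (y ^ (-β))]

/-- Truncated weight. -/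
noncomputable def wt (β M u : ℝ) : ℝ≥0∞ :=
  (Set.Icc (-M) M).indicator (fun u => ENNReal.ofReal (jb u ^ (-β))) u

@[fun_prop] lemma measurable_wt (β M : ℝ) : Measurable (wt β M) := by
  unfold wt
  exact Measurable.indicator (by fun_prop) measurableSet_Icc

lemma wt_of (β M u : ℝ) (h : |u| ≤ M) : wt β M u = ENNReal.ofReal (jb u ^ (-β)) := by
  unfold wt
  rw [Set.indicator_of_mem]
  exact abs_le.1 h

lemma wt_of_not (β M u : ℝ) (h : ¬ |u| ≤ M) : wt β M u = 0 := by
  unfold wt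
  rw [Set.indicator_of_notMem]
  exact fun h' => h (abs_le.2 h')

lemma int_wt (β : ℝ) (hβ : β < 1) (M : ℝ) (hM : 0 ≤ M) :
    ∫⁻ u, wt β M u ≤ ENNReal.ofReal ((2 / (1 - β)) * (1 + M) ^ (1 - β)) := by
  have := int_jb_ball β hβ M hM
  rw [← lintegral_indicator measurableSet_Icc] at this
  exact this

lemma quad_lower (A : ℝ) (hA : A ≠ 0) (q : ℝ) (hq : 0 < q) :
    ∃ C : ℝ, 0 < C ∧ ∀ m : ℝ, ∃ k : ℝ, ∀ z : ℝ,
      jb (A * z ^ 2 + m) ^ (-q) ≤ C * (jb (z - k) ^ (-(2 * q)) + jb (z + k) ^ (-(2 * q))) := by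
  have hA' : 0 < |A| := abs_pos.2 hA
  set c₀ : ℝ := min 1 |A| / 2 with hc₀
  have hc0 : 0 < c₀ := by positivity
  have hc1 : c₀ ≤ 1 / 2 := by rw [hc₀]; linarith [min_le_left 1 |A|]
  have hcA : c₀ ≤ |A| / 2 := by rw [hc₀]; linarith [min_le_right 1 |A|]
  have key : ∀ (w n : ℝ), |A| * n ^ 2 ≤ |w| → jb w ^ (-q) ≤ c₀ ^ (-q) * jb n ^ (-(2 * q)) := by
    intro w n h
    have h1 : c₀ * jb n ^ 2 ≤ jb w := by
      unfold jb
      have : (1 + |n|) ^ 2 ≤ 2 + 2 * n ^ 2 := by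
        nlinarith [sq_nonneg (1 - |n|), sq_abs n]
      nlinarith [sq_nonneg n]
    have hn := jb_pos n
    calc jb w ^ (-q) ≤ (c₀ * jb n ^ 2) ^ (-q) :=
          Real.rpow_le_rpow_of_nonpos (by positivity) h1 (by linarith)
      _ = _ := by
          rw [Real.mul_rpow hc0.le (by positivity), ← Real.rpow_natCast, ← Real.rpow_mul hn.le]
          congr 2; push_cast; ring
  refine ⟨c₀ ^ (-q), by positivity, fun m => ?_⟩
  have hw : ∀ z, |A * z ^ 2 + m| = |A| * |z ^ 2 + m / A| := by
    intro z; rw [← abs_mul]; congr 1; field_simp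
  have pos : ∀ n : ℝ, 0 ≤ c₀ ^ (-q) * jb n ^ (-(2 * q)) := fun n => by
    have := jb_pos n; positivity
  rcases le_total 0 (m / A) with hm | hm
  · refine ⟨0, fun z => ?_⟩
    have := key (A * z ^ 2 + m) (z - 0) (by
      rw [hw, sub_zero]
      gcongr
      rw [abs_of_nonneg (by positivity)]
      linarith)
    linarith [pos (z + 0)]
  · refine ⟨√(-(m / A)), fun z => ?_⟩
    set k := √(-(m / A)) with hk
    have hk2 : k ^ 2 = -(m / A) := Real.sq_sqrt (by linarith)
    have hz : |z ^ 2 + m / A| = |z - k| * |z + k| := by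
      rw [← abs_mul]; congr 1; nlinarith
    rcases le_total |z - k| |z + k| with h | h
    · have := key (A * z ^ 2 + m) (z - k) (by
        rw [hw, hz]
        gcongr
        rw [← sq_abs (z - k), sq]
        gcongr)
      linarith [pos (z + k)]
    · have := key (A * z ^ 2 + m) (z + k) (by
        rw [hw, hz]
        gcongr
        rw [← sq_abs (z + k), sq]
        gcongr)
      linarith [pos (z - k)]

lemma int_crit (A : ℝ) (hA : A ≠ 0) (q : ℝ) (hq : 0 < q) (hq2 : q < 1 / 2) :
    ∃ C : ℝ, 0 < C ∧ ∀ m c L : ℝ, 0 ≤ L →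
      ∫⁻ y in Set.Icc (c - L) (c + L), ENNReal.ofReal (jb (A * (y - c) ^ 2 + m) ^ (-q)) ≤
        ENNReal.ofReal (C * (1 + L) ^ (1 - 2 * q)) := by
  obtain ⟨C, hC, H⟩ := quad_lower A hA q hq
  have hpos : 0 < 2 / (1 - 2 * q) := by
    apply div_pos two_pos; linarith
  refine ⟨C * (2 * (2 / (1 - 2 * q) + 2)), by positivity, fun m c L hL => ?_⟩
  obtain ⟨k, hk⟩ := H m
  have h1 := int_jb_shift (2 * q) (by linarith) (by linarith) c (c + k) L hL
  have h2 := int_jb_shift (2 * q) (by linarith) (by linarith) c (c - k) L hL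
  calc _ ≤ ∫⁻ y in Set.Icc (c - L) (c + L), ENNReal.ofReal C *
        (ENNReal.ofReal (jb (y - (c + k)) ^ (-(2 * q))) +
          ENNReal.ofReal (jb (y - (c - k)) ^ (-(2 * q)))) := by
        apply lintegral_mono
        intro y
        have p1 := jb_pos (y - (c + k))
        have p2 := jb_pos (y - (c - k))
        dsimp only
        rw [← ENNReal.ofReal_add (by positivity) (by positivity), ← ENNReal.ofReal_mul hC.le]
        apply ENNReal.ofReal_le_ofReal
        have := hk (y - c)
        rwa [show y - c - k = y - (c + k) by ring, show y - c + k = y - (c - k) by ring] at this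
    _ = ENNReal.ofReal C * (_ + _) := by
        rw [lintegral_const_mul _ (by fun_prop), lintegral_add_left (by fun_prop)]
    _ ≤ _ := mul_le_mul' le_rfl (add_le_add h1 h2)
    _ = _ := by
        rw [← ENNReal.ofReal_add (by positivity) (by positivity), ← ENNReal.ofReal_mul hC.le]
        congr 1; ring

/-- noncritical piece -/
lemma piece_noncrit (A : ℝ) (hA : A ≠ 0) (α β : ℝ) (hα : α < 1) (hβ : β < 1) (S x : ℝ) :
    ∫⁻ y, ∫⁻ t, ENNReal.ofReal |2 * A * y - 2 * x| * wt α |S| t *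
        wt β |S| (S - t - 2 * x * y + A * y ^ 2) ≤
      ENNReal.ofReal (2 * (2 / (1 - α)) * (2 / (1 - β)) * jb S ^ (2 - α - β)) := by
  have h1 : (0:ℝ) < 1 - α := by linarith
  have h2 : (0:ℝ) < 1 - β := by linarith
  have hj := jb_pos S
  rw [lintegral_lintegral_swap (by fun_prop)]
  calc _ ≤ ∫⁻ t, wt α |S| t * (2 * ∫⁻ u, wt β |S| u) := by
        apply lintegral_mono
        intro t
        have := int_quad A x (S - t) hA (wt β |S|)
        calc _ = ∫⁻ y, wt α |S| t * (ENNReal.ofReal |2 * A * y - 2 * x| *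
              wt β |S| (A * y ^ 2 - 2 * x * y + (S - t))) := by
              refine lintegral_congr fun y => ?_
              rw [show S - t - 2 * x * y + A * y ^ 2 = A * y ^ 2 - 2 * x * y + (S - t) by ring]
              ring
          _ = _ := lintegral_const_mul _ (by fun_prop)
          _ ≤ _ := mul_le_mul' le_rfl this
    _ = (∫⁻ t, wt α |S| t) * (2 * ∫⁻ u, wt β |S| u) := lintegral_mul_const _ (by fun_prop)
    _ ≤ ENNReal.ofReal ((2 / (1 - α)) * jb S ^ (1 - α)) *
        (ENNReal.ofReal 2 * ENNReal.ofReal ((2 / (1 - β)) * jb S ^ (1 - β))) := by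
        gcongr
        · exact int_wt α hα _ (abs_nonneg _)
        · simp
        · exact int_wt β hβ _ (abs_nonneg _)
    _ = _ := by
        rw [← ENNReal.ofReal_mul (by norm_num), ← ENNReal.ofReal_mul (by positivity)]
        congr 1
        rw [show 2 - α - β = (1 - α) + (1 - β) by ring, Real.rpow_add hj]
        ring

/-- critical piece -/
lemma piece_crit (A : ℝ) (hA : A ≠ 0) (D p q : ℝ) (hD : 0 < D) (hq : 0 < q) (hq2 : q < 1/2)
    (hp : p < 1) : ∃ C : ℝ, 0 < C ∧ ∀ S x : ℝ,
    ∫⁻ y, ∫⁻ t, (Set.Icc (x / A - D * jb S ^ (1/2 : ℝ)) (x / A + D * jb S ^ (1/2 : ℝ))).indicator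
        (fun _ => ENNReal.ofReal (D * jb S ^ (1/2 : ℝ))) y * (wt p |S| t *
        ENNReal.ofReal (jb (S - t - 2 * x * y + A * y ^ 2) ^ (-q))) ≤
      ENNReal.ofReal (C * jb S ^ (2 - p - q)) := by
  obtain ⟨C, hC, H⟩ := int_crit A hA q hq hq2
  have h1 : (0:ℝ) < 1 - p := by linarith
  refine ⟨D * C * (1 + D) ^ (1 - 2 * q) * (2 / (1 - p)), by positivity, fun S x => ?_⟩
  have hj := jb_pos S
  have hj1 := jb_ge_one S
  set L := D * jb S ^ (1/2 : ℝ) with hL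
  have hL0 : 0 ≤ L := by positivity
  have hmeas : Measurable ((Set.Icc (x / A - L) (x / A + L)).indicator
        (fun _ => ENNReal.ofReal L)) := measurable_const.indicator measurableSet_Icc
  rw [lintegral_lintegral_swap (by fun_prop)]
  have hLL : (1 + L) ^ (1 - 2 * q) ≤ (1 + D) ^ (1 - 2 * q) * jb S ^ (1/2 - q) := by
    have : 1 + L ≤ (1 + D) * jb S ^ (1/2 : ℝ) := by
      have : 1 ≤ jb S ^ (1/2 : ℝ) := Real.one_le_rpow hj1 (by norm_num)
      rw [hL]; linarith
    calc _ ≤ ((1 + D) * jb S ^ (1/2 : ℝ)) ^ (1 - 2 * q) :=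
          Real.rpow_le_rpow (by positivity) this (by linarith)
      _ = _ := by
          rw [Real.mul_rpow (by positivity) (by positivity), ← Real.rpow_mul hj.le]
          congr 2; ring
  calc _ ≤ ∫⁻ t, wt p |S| t * (ENNReal.ofReal L *
          ENNReal.ofReal (C * ((1 + D) ^ (1 - 2 * q) * jb S ^ (1/2 - q)))) := by
        apply lintegral_mono
        intro t
        have h2 := H (S - t - x ^ 2 / A) (x / A) L hL0
        rw [← lintegral_indicator measurableSet_Icc] at h2
        calc _ = ∫⁻ y, (wt p |S| t * ENNReal.ofReal L) *
                (Set.Icc (x / A - L) (x / A + L)).indicator (fun y =>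
                ENNReal.ofReal (jb (A * (y - x / A) ^ 2 + (S - t - x ^ 2 / A)) ^ (-q))) y := by
              refine lintegral_congr fun y => ?_
              by_cases hy : y ∈ Set.Icc (x / A - L) (x / A + L)
              · simp only [Set.indicator_of_mem hy]
                rw [show A * (y - x / A) ^ 2 + (S - t - x ^ 2 / A) =
                  S - t - 2 * x * y + A * y ^ 2 by field_simp; ring]
                ring
              · simp [Set.indicator_of_notMem hy]
          _ = _ := lintegral_const_mul _ (Measurable.indicator (by fun_prop) measurableSet_Icc)
          _ ≤ _ := mul_le_mul' le_rfl h2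
          _ ≤ _ := by
            rw [mul_assoc]
            exact mul_le_mul' le_rfl (mul_le_mul' le_rfl
              (ENNReal.ofReal_le_ofReal (mul_le_mul_of_nonneg_left hLL hC.le)))
    _ = (∫⁻ t, wt p |S| t) * _ := lintegral_mul_const _ (by fun_prop)
    _ ≤ ENNReal.ofReal ((2 / (1 - p)) * jb S ^ (1 - p)) * _ := 
        mul_le_mul' (int_wt p hp _ (abs_nonneg _)) le_rfl
    _ = _ := by
        rw [← ENNReal.ofReal_mul (by positivity), ← ENNReal.ofReal_mul (by positivity)]
        congr 1
        rw [hL, show 2 - p - q = (1/2) + (1/2 - q) + (1 - p) by ring, Real.rpow_add hj,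
          Real.rpow_add hj]
        ring

lemma main_quad (A : ℝ) (hA : A ≠ 0) (α β : ℝ) (hα : α ∈ Set.Ioo (1/2 : ℝ) 1)
    (hβ : β ∈ Set.Ioo (1/2 : ℝ) 1) (hαβ : α + β < 3 / 2) :
    ∃ C : ℝ, 0 < C ∧ ∀ S x : ℝ,
    ∫⁻ y, ∫⁻ t, (if 1 < |y| then ENNReal.ofReal |y| else 0) * (wt α |S| t *
        wt β |S| (S - t - 2 * x * y + A * y ^ 2)) ≤
      ENNReal.ofReal (C * jb S ^ (2 - α - β)) := by
  obtain ⟨hα1, hα2⟩ := hα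
  obtain ⟨hβ1, hβ2⟩ := hβ
  set p : ℝ := 1/4 + (α + β) / 2 with hp
  set q : ℝ := (α + β) / 2 - 1/4 with hq
  have hA' : 0 < |A| := abs_pos.2 hA
  set D : ℝ := √(6 / |A|) with hD
  have hD0 : 0 < D := by positivity
  have hD2 : D ^ 2 = 6 / |A| := Real.sq_sqrt (by positivity)
  obtain ⟨C₁, hC₁, H₁⟩ := piece_crit A hA D p q hD0 (by rw [hq]; linarith) (by rw [hq]; linarith)
    (by rw [hp]; linarith)
  have hpq : p + q = α + β := by rw [hp, hq]; ring
  have h1 : (0:ℝ) < 1 - α := by linarith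
  have h2 : (0:ℝ) < 1 - β := by linarith
  refine ⟨2 / |A| * (2 * (2 / (1 - α)) * (2 / (1 - β))) + C₁ + C₁, by positivity, fun S x => ?_⟩
  have hj := jb_pos S
  set L := D * jb S ^ (1/2 : ℝ) with hL
  have hL0 : 0 ≤ L := by positivity
  have hL2 : L ^ 2 = 6 / |A| * jb S := by
    rw [hL, mul_pow, hD2, ← Real.rpow_natCast, ← Real.rpow_mul hj.le]; norm_num
  set E := (Set.Icc (x / A - L) (x / A + L)).indicator (fun _ : ℝ => ENNReal.ofReal L) with hE
  have hEm : Measurable E := measurable_const.indicator measurableSet_Icc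
  set w : ℝ → ℝ → ℝ := fun y t => S - t - 2 * x * y + A * y ^ 2 with hw
  have hsw : ∀ y, ∫⁻ t, E y * (wt p |S| (w y t) * ENNReal.ofReal (jb t ^ (-q))) =
      ∫⁻ t, E y * (wt p |S| t * ENNReal.ofReal (jb (w y t) ^ (-q))) := by
    intro y
    rw [← lintegral_sub_left_eq_self _ (S - 2 * x * y + A * y ^ 2)]
    congr 1; ext t
    simp only [hw]
    congr 4
    · ring
    · ring_nf
  have pt : ∀ y t, (if 1 < |y| then ENNReal.ofReal |y| else 0) * (wt α |S| t *
        wt β |S| (w y t)) ≤ ENNReal.ofReal (2 / |A|) * (ENNReal.ofReal |2 * A * y - 2 * x| *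
          wt α |S| t * wt β |S| (w y t)) +
        (E y * (wt p |S| t * ENNReal.ofReal (jb (w y t) ^ (-q))) +
         E y * (wt p |S| (w y t) * ENNReal.ofReal (jb t ^ (-q)))) := by
    intro y t
    by_cases hy : 1 < |y|; swap
    · simp [hy]
    by_cases ht : |t| ≤ |S|; swap
    · simp [wt_of_not _ _ _ ht]
    by_cases hwt : |w y t| ≤ |S|; swap
    · simp [wt_of_not _ _ _ hwt]
    rw [if_pos hy]
    by_cases hc : |A| * |y| / 4 ≤ |x - A * y|
    · refine le_trans ?_ le_self_add
      rw [← mul_assoc, ← mul_assoc, ← mul_assoc, ← ENNReal.ofReal_mul (by positivity)]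
      gcongr
      rw [show 2 * A * y - 2 * x = -2 * (x - A * y) by ring, abs_mul]
      norm_num
      rw [div_mul_eq_mul_div, le_div_iff₀ hA']
      linarith
    · push Not at hc
      refine le_trans ?_ le_add_self
      have hR : |A| / 2 * y ^ 2 ≤ 3 * |S| := by
        have e : y * (2 * x - A * y) = S - t - w y t := by simp only [hw]; ring
        have e1 : |y| * |2 * x - A * y| ≤ 3 * |S| := by
          rw [← abs_mul, e]
          calc _ ≤ |S| + |t| + |w y t| := by
                exact (abs_sub _ _).trans (by gcongr; exact abs_sub _ _)
            _ ≤ _ := by linarith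
        have e2 : |A| * |y| / 2 ≤ |2 * x - A * y| := by
          have : |A * y| ≤ |2 * x - A * y| + |2 * (x - A * y)| := by
            have := abs_sub (2 * x - A * y) (2 * (x - A * y))
            rwa [show 2 * x - A * y - 2 * (x - A * y) = A * y by ring] at this
          rw [abs_mul, abs_mul] at this
          norm_num at this
          linarith
        calc |A| / 2 * y ^ 2 = |y| * (|A| * |y| / 2) := by rw [← sq_abs y]; ring
          _ ≤ |y| * |2 * x - A * y| := by gcongr
          _ ≤ _ := e1
      have hyL : |y| ≤ L := by
        refine abs_le_of_sq_le_sq ?_ hL0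
        rw [hL2, div_mul_eq_mul_div, le_div_iff₀ hA']
        unfold jb; linarith
      have hyE : y ∈ Set.Icc (x / A - L) (x / A + L) := by
        have : |x / A - y| ≤ L := by
          have : |A| * |x / A - y| ≤ |A| * L := by
            rw [← abs_mul, show A * (x / A - y) = x - A * y by field_simp]
            have : |A| * |y| ≤ |A| * L := by gcongr
            have : 0 ≤ |A| * |y| := by positivity
            linarith
          exact le_of_mul_le_mul_left this hA'
        rw [abs_le] at this
        constructor <;> linarith
      have hEy : E y = ENNReal.ofReal L := by rw [hE, Set.indicator_of_mem hyE]
      rw [hEy, ← mul_add, wt_of _ _ _ ht, wt_of _ _ _ ht, wt_of _ _ _ hwt, wt_of _ _ _ hwt]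
      have p1 := jb_pos t
      have p2 := jb_pos (w y t)
      rw [← ENNReal.ofReal_mul (by positivity), ← ENNReal.ofReal_mul (by positivity),
        ← ENNReal.ofReal_mul (by positivity), ← ENNReal.ofReal_mul (by positivity),
        ← ENNReal.ofReal_add (by positivity) (by positivity), ← ENNReal.ofReal_mul (by positivity)]
      gcongr
      exact weight_split _ _ _ _ _ _ (jb_ge_one _) (jb_ge_one _) hpq (by rw [hq]; linarith)
        (by rw [hq]; linarith)
  calc _ ≤ ∫⁻ y, ∫⁻ t, (ENNReal.ofReal (2 / |A|) * (ENNReal.ofReal |2 * A * y - 2 * x| *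
          wt α |S| t * wt β |S| (w y t)) +
        (E y * (wt p |S| t * ENNReal.ofReal (jb (w y t) ^ (-q))) +
         E y * (wt p |S| (w y t) * ENNReal.ofReal (jb t ^ (-q))))) :=
        lintegral_mono fun y => lintegral_mono fun t => pt y t
    _ = ENNReal.ofReal (2 / |A|) * (∫⁻ y, ∫⁻ t, ENNReal.ofReal |2 * A * y - 2 * x| *
          wt α |S| t * wt β |S| (w y t)) +
        ((∫⁻ y, ∫⁻ t, E y * (wt p |S| t * ENNReal.ofReal (jb (w y t) ^ (-q)))) +
         ∫⁻ y, ∫⁻ t, E y * (wt p |S| t * ENNReal.ofReal (jb (w y t) ^ (-q)))) := by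
        have hsw2 := lintegral_congr (μ := volume) hsw
        nth_rw 2 [← hsw2]
        simp only [hw]
        rw [← lintegral_const_mul _ (by fun_prop), ← lintegral_add_left (by fun_prop),
          ← lintegral_add_left (by fun_prop)]
        congr 1; ext y
        rw [← lintegral_const_mul _ (by fun_prop), ← lintegral_add_left (by fun_prop),
          ← lintegral_add_left (by fun_prop)]
    _ ≤ ENNReal.ofReal (2 / |A|) *
        ENNReal.ofReal (2 * (2 / (1 - α)) * (2 / (1 - β)) * jb S ^ (2 - α - β)) +
        (ENNReal.ofReal (C₁ * jb S ^ (2 - p - q)) + ENNReal.ofReal (C₁ * jb S ^ (2 - p - q))) := by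
        gcongr
        · exact piece_noncrit A hA α β hα2 hβ2 S x
        · exact H₁ S x
        · exact H₁ S x
    _ = _ := by
        rw [show 2 - p - q = 2 - α - β by linarith]
        rw [← ENNReal.ofReal_mul (by positivity), ← ENNReal.ofReal_add (by positivity)
          (by positivity), ← ENNReal.ofReal_add (by positivity) (by positivity)]
        congr 1; ring

lemma main_lin (α β : ℝ) (hα : α < 1) (hβ : β < 1) : ∃ C : ℝ, 0 < C ∧ ∀ S x m : ℝ, x ≠ 0 →
    ∫⁻ y, ∫⁻ t, ENNReal.ofReal |x| * (wt α |S| t * wt β |S| (t - 2 * x * y + m)) ≤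
      ENNReal.ofReal (C * jb S ^ (2 - α - β)) := by
  have h1 : (0:ℝ) < 1 - α := by linarith
  have h2 : (0:ℝ) < 1 - β := by linarith
  refine ⟨(2 / (1 - α)) * (2 / (1 - β)), by positivity, fun S x m hx => ?_⟩
  have hj := jb_pos S
  rw [lintegral_lintegral_swap (by fun_prop)]
  calc _ ≤ ∫⁻ t, wt α |S| t * (∫⁻ u, wt β |S| u) := by
        apply lintegral_mono
        intro t
        have := int_lin (-(2 * x)) (t + m) (by simpa using hx) (wt β |S|)
        calc _ ≤ ∫⁻ y, wt α |S| t * (ENNReal.ofReal |-(2 * x)| *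
              wt β |S| (-(2 * x) * y + (t + m))) := by
              apply lintegral_mono
              intro y
              dsimp only
              rw [show t - 2 * x * y + m = -(2 * x) * y + (t + m) by ring, mul_left_comm]
              refine mul_le_mul' le_rfl (mul_le_mul' (ENNReal.ofReal_le_ofReal ?_) le_rfl)
              rw [abs_neg, abs_mul]; norm_num
              linarith [abs_nonneg x]
          _ = _ := lintegral_const_mul _ (by fun_prop)
          _ ≤ _ := mul_le_mul' le_rfl this
    _ = (∫⁻ t, wt α |S| t) * (∫⁻ u, wt β |S| u) := lintegral_mul_const _ (by fun_prop)
    _ ≤ ENNReal.ofReal ((2 / (1 - α)) * jb S ^ (1 - α)) *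
        (ENNReal.ofReal ((2 / (1 - β)) * jb S ^ (1 - β))) := by
        gcongr
        · exact int_wt α hα _ (abs_nonneg _)
        · exact int_wt β hβ _ (abs_nonneg _)
    _ = _ := by
        rw [← ENNReal.ofReal_mul (by positivity)]
        congr 1
        rw [show 2 - α - β = (1 - α) + (1 - β) by ring, Real.rpow_add hj]
        ring

lemma main_low (α β : ℝ) (hα : 0 < α) (hβ : 0 < β) (hαβ : 1 < α + β) :
    ∃ C : ℝ, 0 < C ∧ ∀ m : ℝ → ℝ, Measurable m →
    ∫⁻ y, ∫⁻ t, (if |y| ≤ 1 then 1 else 0) * (ENNReal.ofReal (jb t ^ (-α)) *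
      ENNReal.ofReal (jb (m y - t) ^ (-β))) ≤ ENNReal.ofReal C := by
  have hIntg : Integrable (fun t : ℝ => jb t ^ (-(α + β))) := by
    have := integrable_one_add_norm (E := ℝ) (μ := volume) (r := α + β) (by simpa using hαβ)
    simpa [jb] using this
  set I := ∫⁻ t, ENNReal.ofReal (jb t ^ (-(α + β))) with hI
  have hIfin : I ≠ ∞ := by
    have := hIntg.lintegral_lt_top
    exact this.ne
  have hin : ∀ c : ℝ, ∫⁻ t, ENNReal.ofReal (jb t ^ (-α)) * ENNReal.ofReal (jb (c - t) ^ (-β)) ≤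
      I + I := by
    intro c
    have e : ∫⁻ t, ENNReal.ofReal (jb (c - t) ^ (-(α + β))) = I :=
      lintegral_sub_left_eq_self (fun t => ENNReal.ofReal (jb t ^ (-(α + β)))) c
    calc _ ≤ ∫⁻ t, (ENNReal.ofReal (jb t ^ (-(α + β))) +
          ENNReal.ofReal (jb (c - t) ^ (-(α + β)))) := by
          apply lintegral_mono
          intro t
          have p1 := jb_pos t
          have p2 := jb_pos (c - t)
          dsimp only
          rw [← ENNReal.ofReal_mul (by positivity), ← ENNReal.ofReal_add (by positivity)
            (by positivity)]
          apply ENNReal.ofReal_le_ofReal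
          have := weight_split (jb t) (jb (c - t)) α β (α + β) 0 (jb_ge_one _) (jb_ge_one _)
            (by ring) hα.le hβ.le
          simpa using this
      _ = I + I := by rw [lintegral_add_left (by fun_prop), e]
  refine ⟨2 * (I.toReal + I.toReal) + 1, by positivity, fun m hm => ?_⟩
  calc _ ≤ ∫⁻ y, (Set.Icc (-1:ℝ) 1).indicator (fun _ => I + I) y := by
        apply lintegral_mono
        intro y
        by_cases hy : |y| ≤ 1
        · simp only [hy, if_true, one_mul]
          rw [Set.indicator_of_mem (Set.mem_Icc.2 (abs_le.1 hy))]
          exact hin (m y)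
        · simp [hy]
    _ = (I + I) * 2 := by
        rw [lintegral_indicator measurableSet_Icc, setLIntegral_const, Real.volume_Icc]
        norm_num
    _ = ENNReal.ofReal (2 * (I.toReal + I.toReal)) := by
        rw [ENNReal.ofReal_mul (by norm_num), ENNReal.ofReal_add (by positivity) (by positivity),
          ENNReal.ofReal_toReal hIfin, mul_comm]
        norm_num
    _ ≤ _ := ENNReal.ofReal_le_ofReal (by linarith)

lemma lint_shear (φ : ℝ → ℝ) (hφ : Measurable φ) (H : ℝ → ℝ → ℝ≥0∞)
    (hH : Measurable (Function.uncurry H)) :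
    ∫⁻ q : ℝ × ℝ, H q.2 (q.1 + φ q.2) = ∫⁻ y, ∫⁻ t, H y t := by
  have hm : Measurable (fun q : ℝ × ℝ => H q.2 (q.1 + φ q.2)) := by
    exact hH.comp (g := Function.uncurry H) (f := fun q : ℝ × ℝ => (q.2, q.1 + φ q.2)) (by fun_prop)
  rw [Measure.volume_eq_prod, lintegral_prod_symm _ hm.aemeasurable]
  refine lintegral_congr fun y => ?_
  exact lintegral_add_right_eq_self (fun t => H y t) (φ y)

lemma wt_neg (β M u : ℝ) : wt β M (-u) = wt β M u := by
  by_cases h : |u| ≤ M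
  · rw [wt_of _ _ _ h, wt_of _ _ _ (by rwa [abs_neg]), jb_neg]
  · rw [wt_of_not _ _ _ h, wt_of_not _ _ _ (by rwa [abs_neg])]

/-- model kernel -/
noncomputable def ker (δ b b₁ c : ℝ) (z : (ℝ × ℝ) × (ℝ × ℝ)) : ℝ :=
  jb z.2.2 ^ (1/2 : ℝ) * jb (z.2.1 + δ * z.2.2 ^ 2) ^ (-b) *
    jb (z.1.1 - z.2.1 + (z.1.2 - z.2.2) ^ 2) ^ (-b₁) * jb (z.1.1 + z.1.2 ^ 2) ^ (-c)

@[fun_prop] lemma measurable_ker (δ b b₁ c : ℝ) : Measurable (ker δ b b₁ c) := by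
  unfold ker; fun_prop

lemma ker_sq (δ b b₁ c : ℝ) (z : (ℝ × ℝ) × (ℝ × ℝ)) :
    ENNReal.ofReal (ker δ b b₁ c z) ^ 2 = ENNReal.ofReal (jb z.2.2) *
    (ENNReal.ofReal (jb (z.2.1 + δ * z.2.2 ^ 2) ^ (-(2 * b))) *
    ENNReal.ofReal (jb (z.1.1 - z.2.1 + (z.1.2 - z.2.2) ^ 2) ^ (-(2 * b₁))) *
    ENNReal.ofReal (jb (z.1.1 + z.1.2 ^ 2) ^ (-(2 * c)))) := by
  have h : ∀ x a : ℝ, ENNReal.ofReal (jb x ^ a) ^ 2 = ENNReal.ofReal (jb x ^ (2 * a)) := by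
    intro x a
    have := jb_pos x
    rw [← ENNReal.ofReal_pow (by positivity), ← Real.rpow_natCast, ← Real.rpow_mul this.le]
    congr 2; push_cast; ring
  have j : ∀ x a : ℝ, 0 ≤ jb x ^ a := fun x a => Real.rpow_nonneg (jb_pos x).le _
  unfold ker
  rw [ENNReal.ofReal_mul (mul_nonneg (mul_nonneg (j _ _) (j _ _)) (j _ _)),
    ENNReal.ofReal_mul (mul_nonneg (j _ _) (j _ _)), ENNReal.ofReal_mul (j _ _),
    mul_pow, mul_pow, mul_pow, h, h, h, h]
  simp only [mul_neg]
  norm_num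
  ring

lemma jb_le_two_mul (x : ℝ) (h : 1 < |x|) : ENNReal.ofReal (jb x) ≤ 2 * ENNReal.ofReal |x| := by
  rw [← ENNReal.ofReal_ofNat, ← ENNReal.ofReal_mul (by norm_num)]
  apply ENNReal.ofReal_le_ofReal
  unfold jb; linarith

lemma ofReal_sqrt_sq (C : ℝ) (hC : 0 < C) : ENNReal.ofReal (√C) ^ 2 = ENNReal.ofReal C := by
  rw [← ENNReal.ofReal_pow (by positivity), Real.sq_sqrt hC.le]

lemma final_bound (C S e : ℝ) :
    (2 * ENNReal.ofReal (jb S ^ (-e))) * ENNReal.ofReal (C * jb S ^ e) = ENNReal.ofReal (2 * C) := by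
  have := jb_pos S
  rw [← ENNReal.ofReal_ofNat, ← ENNReal.ofReal_mul (by norm_num), ← ENNReal.ofReal_mul (by positivity)]
  congr 1
  rw [Real.rpow_neg this.le]
  field_simp

def reg0 : Set ((ℝ × ℝ) × (ℝ × ℝ)) := {z | |z.2.2| ≤ 1}
def reg1 (δ : ℝ) : Set ((ℝ × ℝ) × (ℝ × ℝ)) := {z | 1 < |z.2.2| ∧
  |z.1.1 + z.1.2 ^ 2| ≤ |z.2.1 + δ * z.2.2 ^ 2| ∧
  |z.1.1 - z.2.1 + (z.1.2 - z.2.2) ^ 2| ≤ |z.2.1 + δ * z.2.2 ^ 2|}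
def reg2 (δ : ℝ) : Set ((ℝ × ℝ) × (ℝ × ℝ)) := {z | 1 < |z.2.2| ∧
  |z.2.1 + δ * z.2.2 ^ 2| ≤ |z.1.1 + z.1.2 ^ 2| ∧
  |z.1.1 - z.2.1 + (z.1.2 - z.2.2) ^ 2| ≤ |z.1.1 + z.1.2 ^ 2|}
def reg3 (δ : ℝ) : Set ((ℝ × ℝ) × (ℝ × ℝ)) := {z | 1 < |z.2.2| ∧
  |z.2.1 + δ * z.2.2 ^ 2| ≤ |z.1.1 - z.2.1 + (z.1.2 - z.2.2) ^ 2| ∧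
  |z.1.1 + z.1.2 ^ 2| ≤ |z.1.1 - z.2.1 + (z.1.2 - z.2.2) ^ 2|}

lemma measurableSet_and {α : Type*} [MeasurableSpace α] {P Q : α → Prop}
    (hP : MeasurableSet {x | P x}) (hQ : MeasurableSet {x | Q x}) :
    MeasurableSet {x | P x ∧ Q x} := hP.inter hQ

lemma meas_reg0 : MeasurableSet reg0 := measurableSet_le (by fun_prop) (by fun_prop)
lemma meas_reg1 (δ : ℝ) : MeasurableSet (reg1 δ) := by
  unfold reg1
  apply measurableSet_and (measurableSet_lt (by fun_prop) (by fun_prop))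
  exact measurableSet_and (measurableSet_le (by fun_prop) (by fun_prop))
    (measurableSet_le (by fun_prop) (by fun_prop))

lemma meas_reg2 (δ : ℝ) : MeasurableSet (reg2 δ) := by
  unfold reg2
  apply measurableSet_and (measurableSet_lt (by fun_prop) (by fun_prop))
  exact measurableSet_and (measurableSet_le (by fun_prop) (by fun_prop))
    (measurableSet_le (by fun_prop) (by fun_prop))

lemma meas_reg3 (δ : ℝ) : MeasurableSet (reg3 δ) := by
  unfold reg3
  apply measurableSet_and (measurableSet_lt (by fun_prop) (by fun_prop))
  exact measurableSet_and (measurableSet_le (by fun_prop) (by fun_prop))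
    (measurableSet_le (by fun_prop) (by fun_prop))

lemma reg_cover (δ : ℝ) (z) : z ∈ reg0 ∨ z ∈ reg1 δ ∨ z ∈ reg2 δ ∨ z ∈ reg3 δ := by
  simp only [reg0, reg1, reg2, reg3, Set.mem_ofPred_eq]
  rcases le_or_gt |z.2.2| 1 with h | h
  · exact Or.inl h
  · right
    rcases le_total |z.2.1 + δ * z.2.2 ^ 2| |z.1.1 + z.1.2 ^ 2| with h1 | h1
    · rcases le_total |z.1.1 + z.1.2 ^ 2| |z.1.1 - z.2.1 + (z.1.2 - z.2.2) ^ 2| with h3 | h3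
      · exact Or.inr (Or.inr ⟨h, h1.trans h3, h3⟩)
      · exact Or.inr (Or.inl ⟨h, h1, h3⟩)
    · rcases le_total |z.2.1 + δ * z.2.2 ^ 2| |z.1.1 - z.2.1 + (z.1.2 - z.2.2) ^ 2| with h2 | h2
      · exact Or.inr (Or.inr ⟨h, h2, h1.trans h2⟩)
      · exact Or.inl ⟨h, h1, h2⟩

/-- localized kernel -/
noncomputable def lk (δ b b₁ c : ℝ) (R : Set ((ℝ × ℝ) × (ℝ × ℝ))) : (ℝ × ℝ) × (ℝ × ℝ) → ℝ≥0∞ :=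
  R.indicator (fun z => ENNReal.ofReal (ker δ b b₁ c z))

lemma meas_lk (δ b b₁ c : ℝ) {R} (hR : MeasurableSet R) : Measurable (lk δ b b₁ c R) :=
  Measurable.indicator (by fun_prop) hR

noncomputable def chi0 (y : ℝ) : ℝ≥0∞ := if |y| ≤ 1 then 1 else 0
noncomputable def chi1 (y : ℝ) : ℝ≥0∞ := if 1 < |y| then ENNReal.ofReal |y| else 0

@[fun_prop] lemma meas_chi0 : Measurable chi0 :=
  Measurable.ite (measurableSet_le (by fun_prop) (by fun_prop)) (by fun_prop) (by fun_prop)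
@[fun_prop] lemma meas_chi1 : Measurable chi1 :=
  Measurable.ite (measurableSet_lt (by fun_prop) (by fun_prop)) (by fun_prop) (by fun_prop)

lemma bound0 (δ b b₁ c : ℝ) (hb : b ∈ Set.Ioo (1/4 : ℝ) (1/2)) (hb₁ : b₁ ∈ Set.Ioo (1/4 : ℝ) (1/2))
    (hc : c ∈ Set.Ioo (1/4 : ℝ) (1/2)) : ∃ C : ℝ, 0 < C ∧ ∀ p, ∫⁻ q, lk δ b b₁ c reg0 (p, q) ^ 2 ≤ ENNReal.ofReal C := by
  obtain ⟨C, hC, H⟩ := main_low (2 * b) (2 * b₁) (by linarith [hb.1]) (by linarith [hb₁.1])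
    (by linarith [hb.1, hb₁.1])
  refine ⟨2 * C, by positivity, fun p => ?_⟩
  set m : ℝ → ℝ := fun y => p.1 + (p.2 - y) ^ 2 + δ * y ^ 2 with hm
  have hmm : Measurable m := by fun_prop
  calc _ ≤ ∫⁻ q : ℝ × ℝ, 2 * (chi0 q.2 *
          (ENNReal.ofReal (jb (q.1 + δ * q.2 ^ 2) ^ (-(2 * b))) *
            ENNReal.ofReal (jb (m q.2 - (q.1 + δ * q.2 ^ 2)) ^ (-(2 * b₁))))) := by
        apply lintegral_mono
        intro q
        by_cases hq : |q.2| ≤ 1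
        · dsimp only [lk]
          rw [Set.indicator_of_mem (show (p, q) ∈ reg0 from hq), ker_sq, show chi0 q.2 = 1 from if_pos hq, one_mul]
          dsimp only
          rw [show m q.2 - (q.1 + δ * q.2 ^ 2) = p.1 - q.1 + (p.2 - q.2) ^ 2 by
            simp only [hm]; ring]
          refine mul_le_mul' ?_ ?_
          · rw [← ENNReal.ofReal_ofNat]
            apply ENNReal.ofReal_le_ofReal
            unfold jb; linarith
          · conv_rhs => rw [← mul_one (_ * _)]
            refine mul_le_mul' le_rfl ?_
            rw [ENNReal.ofReal_le_one]
            exact Real.rpow_le_one_of_one_le_of_nonpos (jb_ge_one _) (by linarith [hc.1])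
        · dsimp only [lk]
          rw [Set.indicator_of_notMem (show (p, q) ∉ reg0 from hq)]
          simp
    _ = _ := lint_shear (fun y => δ * y ^ 2) (by fun_prop)
          (fun y t => 2 * (chi0 y * (ENNReal.ofReal (jb t ^ (-(2 * b))) *
            ENNReal.ofReal (jb (m y - t) ^ (-(2 * b₁)))))) (by
              unfold Function.uncurry; fun_prop)
    _ = 2 * ∫⁻ y, ∫⁻ t, chi0 y * (ENNReal.ofReal (jb t ^ (-(2 * b))) *
            ENNReal.ofReal (jb (m y - t) ^ (-(2 * b₁)))) := by
        rw [← lintegral_const_mul _ (by fun_prop)]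
        refine lintegral_congr fun y => ?_
        rw [← lintegral_const_mul _ (by fun_prop)]
    _ ≤ 2 * ENNReal.ofReal C := mul_le_mul' le_rfl (H m hmm)
    _ = _ := by rw [ENNReal.ofReal_mul (by norm_num)]; norm_num

lemma bound1 (δ b b₁ c : ℝ) (hb : b ∈ Set.Ioo (1/4 : ℝ) (1/2)) (hb₁ : b₁ ∈ Set.Ioo (1/4 : ℝ) (1/2))
    (hc : c ∈ Set.Ioo (1/4 : ℝ) (1/2)) (hsum : b + b₁ + c = 1) : ∃ C : ℝ, 0 < C ∧
    ∀ q, ∫⁻ p, lk δ b b₁ c (reg1 δ) (p, q) ^ 2 ≤ ENNReal.ofReal C := by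
  obtain ⟨C, hC, H⟩ := main_lin (2 * c) (2 * b₁) (by linarith [hc.2]) (by linarith [hb₁.2])
  refine ⟨2 * C, by positivity, fun q => ?_⟩
  by_cases hq : 1 < |q.2|; swap
  · have : ∀ p, lk δ b b₁ c (reg1 δ) (p, q) ^ 2 = 0 := by
      intro p
      dsimp only [lk]
      rw [Set.indicator_of_notMem (fun h : (p, q) ∈ reg1 δ => hq h.1)]
      simp
    simp [this]
  have hq0 : q.2 ≠ 0 := by
    intro h; rw [h] at hq; simp at hq; linarith
  set S := q.1 + δ * q.2 ^ 2 with hS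
  calc _ ≤ ∫⁻ p : ℝ × ℝ, (2 * ENNReal.ofReal (jb S ^ (-(2 * b)))) * (ENNReal.ofReal |q.2| *
          (wt (2 * c) |S| (p.1 + p.2 ^ 2) *
            wt (2 * b₁) |S| (p.1 + p.2 ^ 2 - 2 * q.2 * p.2 + (q.2 ^ 2 - q.1)))) := by
        apply lintegral_mono
        intro p
        by_cases h : (p, q) ∈ reg1 δ
        · dsimp only [lk]
          rw [Set.indicator_of_mem h, ker_sq]
          obtain ⟨h1, h2, h3⟩ := h
          dsimp only at h1 h2 h3 ⊢
          rw [show p.1 + p.2 ^ 2 - 2 * q.2 * p.2 + (q.2 ^ 2 - q.1) =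
            p.1 - q.1 + (p.2 - q.2) ^ 2 by ring, wt_of _ _ _ h2, wt_of _ _ _ h3]
          refine (mul_le_mul' (jb_le_two_mul _ h1) le_rfl).trans (le_of_eq ?_)
          ring
        · dsimp only [lk]
          rw [Set.indicator_of_notMem h]
          simp
    _ = _ := lint_shear (fun y => y ^ 2) (by fun_prop)
          (fun y t => (2 * ENNReal.ofReal (jb S ^ (-(2 * b)))) * (ENNReal.ofReal |q.2| *
          (wt (2 * c) |S| t *
            wt (2 * b₁) |S| (t - 2 * q.2 * y + (q.2 ^ 2 - q.1))))) (by
              unfold Function.uncurry; fun_prop)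
    _ = (2 * ENNReal.ofReal (jb S ^ (-(2 * b)))) * ∫⁻ y, ∫⁻ t, ENNReal.ofReal |q.2| *
          (wt (2 * c) |S| t * wt (2 * b₁) |S| (t - 2 * q.2 * y + (q.2 ^ 2 - q.1))) := by
        rw [← lintegral_const_mul _ (by fun_prop)]
        refine lintegral_congr fun y => ?_
        rw [← lintegral_const_mul _ (by fun_prop)]
    _ ≤ _ := mul_le_mul' le_rfl (H S q.2 _ hq0)
    _ = _ := by
        rw [show 2 - 2 * c - 2 * b₁ = 2 * b by linarith, final_bound]

lemma bound2 (δ b b₁ c : ℝ) (hb : b ∈ Set.Ioo (1/4 : ℝ) (1/2)) (hb₁ : b₁ ∈ Set.Ioo (1/4 : ℝ) (1/2))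
    (hc : c ∈ Set.Ioo (1/4 : ℝ) (1/2)) (hsum : b + b₁ + c = 1) (hδ : 1 + δ ≠ 0) : ∃ C : ℝ, 0 < C ∧
    ∀ p, ∫⁻ q, lk δ b b₁ c (reg2 δ) (p, q) ^ 2 ≤ ENNReal.ofReal C := by
  obtain ⟨C, hC, H⟩ := main_quad (1 + δ) hδ (2 * b) (2 * b₁)
    ⟨by linarith [hb.1], by linarith [hb.2]⟩ ⟨by linarith [hb₁.1], by linarith [hb₁.2]⟩
    (by linarith [hc.1])
  refine ⟨2 * C, by positivity, fun p => ?_⟩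
  set S := p.1 + p.2 ^ 2 with hS
  calc _ ≤ ∫⁻ q : ℝ × ℝ, (2 * ENNReal.ofReal (jb S ^ (-(2 * c)))) *
          (chi1 q.2 *
          (wt (2 * b) |S| (q.1 + δ * q.2 ^ 2) *
            wt (2 * b₁) |S| (S - (q.1 + δ * q.2 ^ 2) - 2 * p.2 * q.2 + (1 + δ) * q.2 ^ 2))) := by
        apply lintegral_mono
        intro q
        by_cases h : (p, q) ∈ reg2 δ
        · dsimp only [lk]
          rw [Set.indicator_of_mem h, ker_sq]
          obtain ⟨h1, h2, h3⟩ := h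
          dsimp only at h1 h2 h3 ⊢
          rw [show S - (q.1 + δ * q.2 ^ 2) - 2 * p.2 * q.2 + (1 + δ) * q.2 ^ 2 =
            p.1 - q.1 + (p.2 - q.2) ^ 2 by rw [hS]; ring, wt_of _ _ _ h2, wt_of _ _ _ h3,
            show chi1 q.2 = ENNReal.ofReal |q.2| from if_pos h1]
          refine (mul_le_mul' (jb_le_two_mul _ h1) le_rfl).trans (le_of_eq ?_)
          ring
        · dsimp only [lk]
          rw [Set.indicator_of_notMem h]
          simp
    _ = _ := lint_shear (fun y => δ * y ^ 2) (by fun_prop)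
          (fun y t => (2 * ENNReal.ofReal (jb S ^ (-(2 * c)))) *
          (chi1 y *
          (wt (2 * b) |S| t *
            wt (2 * b₁) |S| (S - t - 2 * p.2 * y + (1 + δ) * y ^ 2)))) (by
              unfold Function.uncurry; fun_prop)
    _ = (2 * ENNReal.ofReal (jb S ^ (-(2 * c)))) * ∫⁻ y, ∫⁻ t, chi1 y *
          (wt (2 * b) |S| t * wt (2 * b₁) |S| (S - t - 2 * p.2 * y + (1 + δ) * y ^ 2)) := by
        rw [← lintegral_const_mul _ (by fun_prop)]
        refine lintegral_congr fun y => ?_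
        rw [← lintegral_const_mul _ (by fun_prop)]
    _ ≤ _ := mul_le_mul' le_rfl (H S p.2)
    _ = _ := by
        rw [show 2 - 2 * b - 2 * b₁ = 2 * c by linarith, final_bound]

lemma bound3 (δ b b₁ c : ℝ) (hb : b ∈ Set.Ioo (1/4 : ℝ) (1/2)) (hb₁ : b₁ ∈ Set.Ioo (1/4 : ℝ) (1/2))
    (hc : c ∈ Set.Ioo (1/4 : ℝ) (1/2)) (hsum : b + b₁ + c = 1) (hδ : δ - 1 ≠ 0) : ∃ C : ℝ, 0 < C ∧
    ∀ r, ∫⁻ q, lk δ b b₁ c (reg3 δ) (r + q, q) ^ 2 ≤ ENNReal.ofReal C := by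
  obtain ⟨C, hC, H⟩ := main_quad (δ - 1) hδ (2 * b) (2 * c)
    ⟨by linarith [hb.1], by linarith [hb.2]⟩ ⟨by linarith [hc.1], by linarith [hc.2]⟩
    (by linarith [hb₁.1])
  refine ⟨2 * C, by positivity, fun r => ?_⟩
  set S := -(r.1 + r.2 ^ 2) with hS
  calc _ ≤ ∫⁻ q : ℝ × ℝ, (2 * ENNReal.ofReal (jb S ^ (-(2 * b₁)))) *
          (chi1 q.2 *
          (wt (2 * b) |S| (q.1 + δ * q.2 ^ 2) *
            wt (2 * c) |S| (S - (q.1 + δ * q.2 ^ 2) - 2 * r.2 * q.2 + (δ - 1) * q.2 ^ 2))) := by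
        apply lintegral_mono
        intro q
        by_cases h : (r + q, q) ∈ reg3 δ
        · dsimp only [lk]
          rw [Set.indicator_of_mem h, ker_sq]
          obtain ⟨h1, h2, h3⟩ := h
          dsimp only at h1 h2 h3 ⊢
          have e : (r + q).1 - q.1 + ((r + q).2 - q.2) ^ 2 = -S := by
            simp [hS]
          rw [e, abs_neg] at h2 h3
          rw [e, show S - (q.1 + δ * q.2 ^ 2) - 2 * r.2 * q.2 + (δ - 1) * q.2 ^ 2 =
            -((r + q).1 + (r + q).2 ^ 2) by simp [hS]; ring, wt_neg, wt_of _ _ _ h2,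
            wt_of _ _ _ h3, show chi1 q.2 = ENNReal.ofReal |q.2| from if_pos h1, jb_neg]
          refine (mul_le_mul' (jb_le_two_mul _ h1) le_rfl).trans (le_of_eq ?_)
          ring
        · dsimp only [lk]
          rw [Set.indicator_of_notMem h]
          simp
    _ = _ := lint_shear (fun y => δ * y ^ 2) (by fun_prop)
          (fun y t => (2 * ENNReal.ofReal (jb S ^ (-(2 * b₁)))) *
          (chi1 y *
          (wt (2 * b) |S| t *
            wt (2 * c) |S| (S - t - 2 * r.2 * y + (δ - 1) * y ^ 2)))) (by
              unfold Function.uncurry; fun_prop)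
    _ = (2 * ENNReal.ofReal (jb S ^ (-(2 * b₁)))) * ∫⁻ y, ∫⁻ t, chi1 y *
          (wt (2 * b) |S| t * wt (2 * c) |S| (S - t - 2 * r.2 * y + (δ - 1) * y ^ 2)) := by
        rw [← lintegral_const_mul _ (by fun_prop)]
        refine lintegral_congr fun y => ?_
        rw [← lintegral_const_mul _ (by fun_prop)]
    _ ≤ _ := mul_le_mul' le_rfl (H S r.2)
    _ = _ := by
        rw [show 2 - 2 * b - 2 * c = 2 * b₁ by linarith, final_bound]

lemma model_bound (δ b b₁ c : ℝ) (hb : b ∈ Set.Ioo (1/4 : ℝ) (1/2)) (hb₁ : b₁ ∈ Set.Ioo (1/4 : ℝ) (1/2))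
    (hc : c ∈ Set.Ioo (1/4 : ℝ) (1/2)) (hsum : b + b₁ + c = 1) (hδ1 : 1 + δ ≠ 0) (hδ2 : δ - 1 ≠ 0) : ∃ C : ℝ, 0 < C ∧
    ∀ f g : ℝ × ℝ → ℝ≥0∞, Measurable f → Measurable g →
      nrm (fun p => ∫⁻ q, ENNReal.ofReal (ker δ b b₁ c (p, q)) * f q * g (p - q)) ≤
        ENNReal.ofReal C * nrm f * nrm g := by
  obtain ⟨C₀, hC₀, H₀⟩ := bound0 δ b b₁ c hb hb₁ hc
  obtain ⟨C₁, hC₁, H₁⟩ := bound1 δ b b₁ c hb hb₁ hc hsum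
  obtain ⟨C₂, hC₂, H₂⟩ := bound2 δ b b₁ c hb hb₁ hc hsum hδ1
  obtain ⟨C₃, hC₃, H₃⟩ := bound3 δ b b₁ c hb hb₁ hc hsum hδ2
  refine ⟨√C₀ + √C₁ + √C₂ + √C₃, by positivity, fun f g hf hg => ?_⟩
  apply nrm_le_of_dual _ (Measurable.lintegral_prod_right' (f := fun z : (ℝ × ℝ) × (ℝ × ℝ) =>
    ENNReal.ofReal (ker δ b b₁ c z) * f z.2 * g (z.1 - z.2)) (by fun_prop))
  intro h hh
  have m0 := meas_lk δ b b₁ c meas_reg0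
  have m1 := meas_lk δ b b₁ c (meas_reg1 δ)
  have m2 := meas_lk δ b b₁ c (meas_reg2 δ)
  have m3 := meas_lk δ b b₁ c (meas_reg3 δ)
  have T0 := cs_p _ m0 (ENNReal.ofReal √C₀)
    (by rw [ofReal_sqrt_sq _ hC₀]; exact H₀) f g h hf hg hh
  have T1 := cs_q _ m1 (ENNReal.ofReal √C₁)
    (by rw [ofReal_sqrt_sq _ hC₁]; exact H₁) f g h hf hg hh
  have T2 := cs_p _ m2 (ENNReal.ofReal √C₂)
    (by rw [ofReal_sqrt_sq _ hC₂]; exact H₂) f g h hf hg hh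
  have T3 := cs_r _ m3 (ENNReal.ofReal √C₃)
    (by rw [ofReal_sqrt_sq _ hC₃]; exact H₃) f g h hf hg hh
  have pt : ∀ z, ENNReal.ofReal (ker δ b b₁ c z) ≤ lk δ b b₁ c reg0 z + lk δ b b₁ c (reg1 δ) z +
      lk δ b b₁ c (reg2 δ) z + lk δ b b₁ c (reg3 δ) z := by
    intro z
    rcases reg_cover δ z with hz | hz | hz | hz
    · have : lk δ b b₁ c reg0 z = ENNReal.ofReal (ker δ b b₁ c z) := Set.indicator_of_mem hz _
      rw [this, add_assoc, add_assoc]; exact le_self_add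
    · have : lk δ b b₁ c (reg1 δ) z = ENNReal.ofReal (ker δ b b₁ c z) := Set.indicator_of_mem hz _
      rw [this, add_comm (lk δ b b₁ c reg0 z), add_assoc, add_assoc]; exact le_self_add
    · have : lk δ b b₁ c (reg2 δ) z = ENNReal.ofReal (ker δ b b₁ c z) := Set.indicator_of_mem hz _
      rw [this, add_right_comm]; exact le_add_self
    · have : lk δ b b₁ c (reg3 δ) z = ENNReal.ofReal (ker δ b b₁ c z) := Set.indicator_of_mem hz _
      rw [this]; exact le_add_self
  calc _ = ∫⁻ p, ∫⁻ q, ENNReal.ofReal (ker δ b b₁ c (p, q)) * f q * g (p - q) * h p := by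
        refine lintegral_congr fun p => ?_
        rw [lintegral_mul_const _ (by fun_prop)]
    _ ≤ ∫⁻ p, ∫⁻ q, (lk δ b b₁ c reg0 (p, q) * f q * g (p - q) * h p +
          lk δ b b₁ c (reg1 δ) (p, q) * f q * g (p - q) * h p +
          lk δ b b₁ c (reg2 δ) (p, q) * f q * g (p - q) * h p +
          lk δ b b₁ c (reg3 δ) (p, q) * f q * g (p - q) * h p) := by
        refine lintegral_mono fun p => lintegral_mono fun q => ?_
        dsimp only
        simp only [← add_mul]
        gcongr
        exact pt _
    _ = (∫⁻ p, ∫⁻ q, lk δ b b₁ c reg0 (p, q) * f q * g (p - q) * h p) +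
          (∫⁻ p, ∫⁻ q, lk δ b b₁ c (reg1 δ) (p, q) * f q * g (p - q) * h p) +
          (∫⁻ p, ∫⁻ q, lk δ b b₁ c (reg2 δ) (p, q) * f q * g (p - q) * h p) +
          (∫⁻ p, ∫⁻ q, lk δ b b₁ c (reg3 δ) (p, q) * f q * g (p - q) * h p) := by
        rw [← lintegral_add_left (by fun_prop), ← lintegral_add_left (by fun_prop),
          ← lintegral_add_left (by fun_prop)]
        refine lintegral_congr fun p => ?_
        rw [← lintegral_add_left (by fun_prop), ← lintegral_add_left (by fun_prop),
          ← lintegral_add_left (by fun_prop)]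
    _ ≤ _ := add_le_add (add_le_add (add_le_add T0 T1) T2) T3
    _ = _ := by
        rw [ENNReal.ofReal_add (by positivity) (by positivity),
          ENNReal.ofReal_add (by positivity) (by positivity),
          ENNReal.ofReal_add (by positivity) (by positivity)]
        ring

lemma nrm_mono {f g : ℝ × ℝ → ℝ≥0∞} (h : ∀ p, f p ≤ g p) : nrm f ≤ nrm g := by
  unfold nrm
  refine ENNReal.rpow_le_rpow (lintegral_mono fun p => ?_) (by norm_num)
  exact pow_le_pow_left' (h p) 2

lemma nrm_add {f g : ℝ × ℝ → ℝ≥0∞} (hf : Measurable f) (hg : Measurable g) :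
    nrm (fun p => f p + g p) ≤ nrm f + nrm g := by
  have := ENNReal.lintegral_Lp_add_le (μ := (volume : Measure (ℝ × ℝ))) (p := 2)
    hf.aemeasurable hg.aemeasurable (by norm_num)
  simpa [nrm] using this

lemma nrm_const_mul (K : ℝ≥0∞) {f : ℝ × ℝ → ℝ≥0∞} (hf : Measurable f) :
    nrm (fun p => K * f p) = K * nrm f := by
  unfold nrm
  simp_rw [mul_pow]
  rw [lintegral_const_mul _ (by fun_prop), ENNReal.mul_rpow_of_nonneg _ _ (by norm_num),
    sq_rpow_half]

lemma jb_rpow_split (x y s : ℝ) (hs : 0 ≤ s) :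
    jb (x + y) ^ s ≤ 2 ^ s * (jb x ^ s + jb y ^ s) := by
  have hx := jb_pos x
  have hy := jb_pos y
  have hxs : 0 ≤ jb x ^ s := Real.rpow_nonneg hx.le _
  have hys : 0 ≤ jb y ^ s := Real.rpow_nonneg hy.le _
  have h2 : (0:ℝ) ≤ 2 ^ s := Real.rpow_nonneg (by norm_num) _
  have h : jb (x + y) ≤ jb x + jb y := by
    unfold jb; linarith [abs_add_le x y]
  rcases le_total (jb x) (jb y) with hxy | hxy
  · calc jb (x + y) ^ s ≤ (2 * jb y) ^ s :=
          Real.rpow_le_rpow (jb_pos _).le (by linarith) hs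
      _ = 2 ^ s * jb y ^ s := Real.mul_rpow (by norm_num) hy.le
      _ ≤ _ := mul_le_mul_of_nonneg_left (by linarith) h2
  · calc jb (x + y) ^ s ≤ (2 * jb x) ^ s :=
          Real.rpow_le_rpow (jb_pos _).le (by linarith) hs
      _ = 2 ^ s * jb x ^ s := Real.mul_rpow (by norm_num) hx.le
      _ ≤ _ := mul_le_mul_of_nonneg_left (by linarith) h2

lemma ker_nonneg (δ b b₁ c : ℝ) (z) : 0 ≤ ker δ b b₁ c z := by
  have j : ∀ x a : ℝ, 0 ≤ jb x ^ a := fun x a => Real.rpow_nonneg (jb_pos x).le _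
  exact mul_nonneg (mul_nonneg (mul_nonneg (j _ _) (j _ _)) (j _ _)) (j _ _)

lemma ker_lower_aux (δ b b₁ c b' b₁' c' w : ℝ) (hb : b' ≤ b) (hb₁ : b₁' ≤ b₁) (hc : c' ≤ c)
    (p q : ℝ × ℝ) (hw : w = q.1 + δ * q.2 ^ 2) :
    jb (p.1 + p.2 ^ 2) ^ (-c) ≤ ker δ b' b₁' c' (p, q) *
      (jb q.2 ^ (-(1/2) : ℝ) * jb w ^ b) * jb ((p - q).1 + (p - q).2 ^ 2) ^ b₁ := by
  have j : ∀ x a : ℝ, 0 < jb x ^ a := fun x a => Real.rpow_pos_of_pos (jb_pos x) _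
  have k : ∀ x a a' : ℝ, a' ≤ a → 1 ≤ jb x ^ (-a') * jb x ^ a := by
    intro x a a' h
    rw [← Real.rpow_add (jb_pos x)]
    exact Real.one_le_rpow (jb_ge_one x) (by linarith)
  have k0 : jb q.2 ^ (1/2 : ℝ) * jb q.2 ^ (-(1/2) : ℝ) = 1 := by
    rw [← Real.rpow_add (jb_pos _)]; norm_num
  have e : ker δ b' b₁' c' (p, q) *
      (jb q.2 ^ (-(1/2) : ℝ) * jb w ^ b) * jb ((p - q).1 + (p - q).2 ^ 2) ^ b₁ =
      (jb q.2 ^ (1/2 : ℝ) * jb q.2 ^ (-(1/2) : ℝ)) * (jb w ^ (-b') * jb w ^ b) *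
      (jb ((p - q).1 + (p - q).2 ^ 2) ^ (-b₁') * jb ((p - q).1 + (p - q).2 ^ 2) ^ b₁) *
      jb (p.1 + p.2 ^ 2) ^ (-c') := by
    simp only [ker, ← hw, Prod.fst_sub, Prod.snd_sub]
    ring
  rw [e, k0, one_mul]
  have h1 := one_le_mul_of_one_le_of_one_le (k w b b' hb)
    (k ((p - q).1 + (p - q).2 ^ 2) b₁ b₁' hb₁)
  calc _ ≤ jb (p.1 + p.2 ^ 2) ^ (-c') :=
        Real.rpow_le_rpow_of_exponent_le (jb_ge_one _) (by linarith)
    _ ≤ _ := le_mul_of_one_le_left (j _ _).le h1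

lemma ker_lower (γ b b₁ c b' b₁' c' : ℝ) (hb : b' ≤ b) (hb₁ : b₁' ≤ b₁) (hc : c' ≤ c)
    (p q : ℝ × ℝ) :
    jb (p.1 + p.2 ^ 2) ^ (-c) ≤ (ker γ b' b₁' c' (p, q) + ker (-γ) b' b₁' c' (p, q)) *
      (jb q.2 ^ (-(1/2) : ℝ) * jb (q.1 + γ * |q.2| * q.2) ^ b) *
        jb ((p - q).1 + (p - q).2 ^ 2) ^ b₁ := by
  have j : ∀ x a : ℝ, 0 ≤ jb x ^ a := fun x a => Real.rpow_nonneg (jb_pos x).le _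
  have n1 := ker_nonneg γ b' b₁' c' (p, q)
  have n2 := ker_nonneg (-γ) b' b₁' c' (p, q)
  rcases le_total 0 q.2 with h | h
  · refine (ker_lower_aux γ b b₁ c b' b₁' c' (q.1 + γ * |q.2| * q.2) hb hb₁ hc p q
      (by rw [abs_of_nonneg h]; ring)).trans ?_
    refine mul_le_mul_of_nonneg_right (mul_le_mul_of_nonneg_right (by linarith) ?_) (j _ _)
    exact mul_nonneg (j _ _) (j _ _)
  · refine (ker_lower_aux (-γ) b b₁ c b' b₁' c' (q.1 + γ * |q.2| * q.2) hb hb₁ hc p q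
      (by rw [abs_of_nonpos h]; ring)).trans ?_
    refine mul_le_mul_of_nonneg_right (mul_le_mul_of_nonneg_right (by linarith) ?_) (j _ _)
    exact mul_nonneg (j _ _) (j _ _)

/-- Pointwise reduction of the integrand to the model kernels. -/
lemma integrand_bound (γ b b₁ c b' b₁' c' s : ℝ) (hs : 0 ≤ s)
    (hb : b' ≤ b) (hb₁ : b₁' ≤ b₁) (hc : c' ≤ c)
    (F G : ℝ × ℝ → ℝ) (hF : ∀ p, 0 ≤ F p) (hG : ∀ p, 0 ≤ G p) (p q : ℝ × ℝ) :
    jb p.2 ^ s * jb (p.1 + p.2 ^ 2) ^ (-c) * (F q * G (p - q)) ≤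
    2 ^ s * ((ker γ b' b₁' c' (p, q) + ker (-γ) b' b₁' c' (p, q)) *
        (jb q.2 ^ (s - 1/2) * jb (q.1 + γ * |q.2| * q.2) ^ b * F q) *
        (jb ((p - q).1 + (p - q).2 ^ 2) ^ b₁ * G (p - q)) +
      (ker γ b' b₁' c' (p, q) + ker (-γ) b' b₁' c' (p, q)) *
        (jb q.2 ^ (-(1/2) : ℝ) * jb (q.1 + γ * |q.2| * q.2) ^ b * F q) *
        (jb (p - q).2 ^ s * jb ((p - q).1 + (p - q).2 ^ 2) ^ b₁ * G (p - q))) := by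
  have j : ∀ x a : ℝ, 0 ≤ jb x ^ a := fun x a => Real.rpow_nonneg (jb_pos x).le _
  have h1 := ker_lower γ b b₁ c b' b₁' c' hb hb₁ hc p q
  have h2 := jb_rpow_split q.2 (p - q).2 s hs
  rw [show q.2 + (p - q).2 = p.2 by simp] at h2
  have h3 : jb q.2 ^ (s - 1/2) = jb q.2 ^ s * jb q.2 ^ (-(1/2) : ℝ) := by
    rw [← Real.rpow_add (jb_pos _)]; congr 1
  have h4 := mul_le_mul h2 h1 (j _ _) ((j _ _).trans h2)
  refine (mul_le_mul_of_nonneg_right h4 (mul_nonneg (hF q) (hG (p - q)))).trans (le_of_eq ?_)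
  rw [h3]
  ring

lemma exponents (b b₁ c : ℝ) (hb : b ∈ Set.Ioo (1/4 : ℝ) (1/2))
    (hb₁ : b₁ ∈ Set.Ioo (1/4 : ℝ) (1/2)) (hc : c ∈ Set.Ioo (1/4 : ℝ) (1/2))
    (hsum : 1 ≤ b + b₁ + c) : ∃ b' b₁' c' : ℝ, b' ≤ b ∧ b₁' ≤ b₁ ∧ c' ≤ c ∧
      b' ∈ Set.Ioo (1/4 : ℝ) (1/2) ∧ b₁' ∈ Set.Ioo (1/4 : ℝ) (1/2) ∧
      c' ∈ Set.Ioo (1/4 : ℝ) (1/2) ∧ b' + b₁' + c' = 1 := by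
  obtain ⟨hb1, hb2⟩ := hb
  obtain ⟨hb₁1, hb₁2⟩ := hb₁
  obtain ⟨hc1, hc2⟩ := hc
  set D := b + b₁ + c - 3/4 with hD
  have hDpos : 1/4 ≤ D := by linarith
  set μ := (1/4) / D with hμ
  have hμ0 : 0 < μ := by positivity
  have hμ1 : μ ≤ 1 := by rw [hμ, div_le_one (by linarith)]; exact hDpos
  have hμD : μ * D = 1/4 := by rw [hμ]; field_simp
  have key : ∀ x : ℝ, 1/4 < x → x < 1/2 →
      1/4 + μ * (x - 1/4) ≤ x ∧ 1/4 + μ * (x - 1/4) ∈ Set.Ioo (1/4 : ℝ) (1/2) := by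
    intro x h1 h2
    have : 1/4 + μ * (x - 1/4) ≤ x := by nlinarith
    have h3 : 0 < μ * (x - 1/4) := mul_pos hμ0 (by linarith)
    exact ⟨this, by linarith, by linarith⟩
  refine ⟨1/4 + μ * (b - 1/4), 1/4 + μ * (b₁ - 1/4), 1/4 + μ * (c - 1/4), (key b hb1 hb2).1,
    (key b₁ hb₁1 hb₁2).1, (key c hc1 hc2).1, (key b hb1 hb2).2, (key b₁ hb₁1 hb₁2).2,
    (key c hc1 hc2).2, ?_⟩
  have : μ * D = μ * (b - 1/4) + μ * (b₁ - 1/4) + μ * (c - 1/4) := by rw [hD]; ring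
  linarith

/-- The model bilinear operator. -/
noncomputable def Tm (δ b b₁ c : ℝ) (f g : ℝ × ℝ → ℝ≥0∞) (p : ℝ × ℝ) : ℝ≥0∞ :=
  ∫⁻ q, ENNReal.ofReal (ker δ b b₁ c (p, q)) * f q * g (p - q)

lemma meas_Tm (δ b b₁ c : ℝ) {f g : ℝ × ℝ → ℝ≥0∞} (hf : Measurable f) (hg : Measurable g) :
    Measurable (Tm δ b b₁ c f g) :=
  Measurable.lintegral_prod_right' (f := fun z : (ℝ × ℝ) × (ℝ × ℝ) =>
    ENNReal.ofReal (ker δ b b₁ c z) * f z.2 * g (z.1 - z.2)) (by fun_prop)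

lemma pointwise_bound (γ b b₁ c b' b₁' c' s : ℝ) (hs : 0 ≤ s)
    (hb : b' ≤ b) (hb₁ : b₁' ≤ b₁) (hc : c' ≤ c)
    (F G : ℝ × ℝ → ℝ) (hFm : Measurable F) (hGm : Measurable G)
    (hF : ∀ p, 0 ≤ F p) (hG : ∀ p, 0 ≤ G p) (fs f0 g0 gs : ℝ × ℝ → ℝ≥0∞)
    (hfs : fs = fun p => ENNReal.ofReal
      (jb p.2 ^ (s - 1/2) * jb (p.1 + γ * |p.2| * p.2) ^ b * F p))
    (hf0 : f0 = fun p => ENNReal.ofReal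
      (jb p.2 ^ (-(1/2) : ℝ) * jb (p.1 + γ * |p.2| * p.2) ^ b * F p))
    (hg0 : g0 = fun p => ENNReal.ofReal (jb (p.1 + p.2 ^ 2) ^ b₁ * G p))
    (hgs : gs = fun p => ENNReal.ofReal (jb p.2 ^ s * jb (p.1 + p.2 ^ 2) ^ b₁ * G p))
    (p : ℝ × ℝ) :
    ENNReal.ofReal (jb p.2 ^ s * jb (p.1 + p.2 ^ 2) ^ (-c)) * convR2 F G p ≤
      ENNReal.ofReal (2 ^ s) * ((Tm γ b' b₁' c' fs g0 p + Tm (-γ) b' b₁' c' fs g0 p) +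
        (Tm γ b' b₁' c' f0 gs p + Tm (-γ) b' b₁' c' f0 gs p)) := by
  have j : ∀ x a : ℝ, 0 ≤ jb x ^ a := fun x a => Real.rpow_nonneg (jb_pos x).le _
  have m1 : Measurable fs := by rw [hfs]; fun_prop
  have m2 : Measurable f0 := by rw [hf0]; fun_prop
  have m3 : Measurable g0 := by rw [hg0]; fun_prop
  have m4 : Measurable gs := by rw [hgs]; fun_prop
  unfold convR2 Tm
  rw [← lintegral_const_mul _ (by fun_prop), ← lintegral_add_left (by fun_prop),
    ← lintegral_add_left (by fun_prop), ← lintegral_add_left (by fun_prop),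
    ← lintegral_const_mul _ (by fun_prop)]
  refine lintegral_mono fun q => ?_
  have n1 := ker_nonneg γ b' b₁' c' (p, q)
  have n2 := ker_nonneg (-γ) b' b₁' c' (p, q)
  have nfs : 0 ≤ jb q.2 ^ (s - 1/2) * jb (q.1 + γ * |q.2| * q.2) ^ b * F q :=
    mul_nonneg (mul_nonneg (j _ _) (j _ _)) (hF q)
  have nf0 : 0 ≤ jb q.2 ^ (-(1/2) : ℝ) * jb (q.1 + γ * |q.2| * q.2) ^ b * F q :=
    mul_nonneg (mul_nonneg (j _ _) (j _ _)) (hF q)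
  have ng0 : 0 ≤ jb ((p - q).1 + (p - q).2 ^ 2) ^ b₁ * G (p - q) := mul_nonneg (j _ _) (hG _)
  have ngs : 0 ≤ jb (p - q).2 ^ s * jb ((p - q).1 + (p - q).2 ^ 2) ^ b₁ * G (p - q) :=
    mul_nonneg (mul_nonneg (j _ _) (j _ _)) (hG _)
  have h := ENNReal.ofReal_le_ofReal
    (integrand_bound γ b b₁ c b' b₁' c' s hs hb hb₁ hc F G hF hG p q)
  rw [ENNReal.ofReal_mul (mul_nonneg (j _ _) (j _ _))] at h
  refine h.trans (le_of_eq ?_)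
  rw [ENNReal.ofReal_mul (Real.rpow_nonneg (by norm_num) _),
    ENNReal.ofReal_add (mul_nonneg (mul_nonneg (add_nonneg n1 n2) nfs) ng0)
      (mul_nonneg (mul_nonneg (add_nonneg n1 n2) nf0) ngs),
    ENNReal.ofReal_mul (mul_nonneg (add_nonneg n1 n2) nfs),
    ENNReal.ofReal_mul (mul_nonneg (add_nonneg n1 n2) nf0),
    ENNReal.ofReal_mul (add_nonneg n1 n2), ENNReal.ofReal_mul (add_nonneg n1 n2),
    ENNReal.ofReal_add n1 n2, hfs, hf0, hg0, hgs]
  ring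

/-- Fourier-side formulation of
`‖uv‖_{X^{s,−c₁}} ≲ ‖u‖_{Y_γ^{s−1/2,b}}‖v‖_{X^{0,b₁}} + ‖u‖_{Y_γ^{−1/2,b}}‖v‖_{X^{s,b₁}}`,
with `F = û`, `G = v̂`.  Points of `ℝ²` are `p = (τ, ξ)`. -/
theorem bilinear_estimate_Xs (γ b b₁ c₁ s : ℝ) (hγ : γ ≠ 0) (hγ1 : |γ| ≠ 1)
    (hb : b ∈ Set.Ioo (1/4 : ℝ) (1/2)) (hb₁ : b₁ ∈ Set.Ioo (1/4 : ℝ) (1/2))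
    (hc₁ : c₁ ∈ Set.Ioo (1/4 : ℝ) (1/2)) (hsum : 1 ≤ b + b₁ + c₁) (hs : 0 ≤ s) :
    ∃ C : ℝ, 0 < C ∧ ∀ F G : ℝ × ℝ → ℝ,
      Measurable F → Measurable G → (∀ p, 0 ≤ F p) → (∀ p, 0 ≤ G p) →
      (∫⁻ p : ℝ × ℝ,
          (ENNReal.ofReal (jb p.2 ^ s * jb (p.1 + p.2 ^ 2) ^ (-c₁)) * convR2 F G p) ^ 2)
        ^ (1/2 : ℝ)
      ≤ ENNReal.ofReal C *
        (l2R2 (fun p => jb p.2 ^ (s - 1/2) * jb (p.1 + γ * |p.2| * p.2) ^ b * F p) *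
           l2R2 (fun p => jb (p.1 + p.2 ^ 2) ^ b₁ * G p)
         + l2R2 (fun p => jb p.2 ^ (-(1/2) : ℝ) * jb (p.1 + γ * |p.2| * p.2) ^ b * F p) *
           l2R2 (fun p => jb p.2 ^ s * jb (p.1 + p.2 ^ 2) ^ b₁ * G p)) := by
  obtain ⟨b', b₁', c', lb, lb₁, lc, hb', hb₁', hc', hsum'⟩ := exponents b b₁ c₁ hb hb₁ hc₁ hsum
  have hg1 : γ ≠ 1 := fun h => hγ1 (by rw [h]; simp)
  have hg2 : γ ≠ -1 := fun h => hγ1 (by rw [h]; simp)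
  obtain ⟨C₁, hC₁, H₁⟩ := model_bound γ b' b₁' c' hb' hb₁' hc' hsum'
    (fun h => hg2 (by linarith)) (fun h => hg1 (by linarith))
  obtain ⟨C₂, hC₂, H₂⟩ := model_bound (-γ) b' b₁' c' hb' hb₁' hc' hsum'
    (fun h => hg1 (by linarith)) (fun h => hg2 (by linarith))
  have h2s : (0:ℝ) < 2 ^ s := Real.rpow_pos_of_pos (by norm_num) _
  refine ⟨2 ^ s * (C₁ + C₂), by positivity, fun F G hFm hGm hF hG => ?_⟩
  set fs : ℝ × ℝ → ℝ≥0∞ := fun p => ENNReal.ofReal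
      (jb p.2 ^ (s - 1/2) * jb (p.1 + γ * |p.2| * p.2) ^ b * F p) with hfs
  set f0 : ℝ × ℝ → ℝ≥0∞ := fun p => ENNReal.ofReal
      (jb p.2 ^ (-(1/2) : ℝ) * jb (p.1 + γ * |p.2| * p.2) ^ b * F p) with hf0
  set g0 : ℝ × ℝ → ℝ≥0∞ := fun p => ENNReal.ofReal (jb (p.1 + p.2 ^ 2) ^ b₁ * G p) with hg0
  set gs : ℝ × ℝ → ℝ≥0∞ := fun p => ENNReal.ofReal
      (jb p.2 ^ s * jb (p.1 + p.2 ^ 2) ^ b₁ * G p) with hgs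
  have m1 : Measurable fs := by fun_prop
  have m2 : Measurable f0 := by fun_prop
  have m3 : Measurable g0 := by fun_prop
  have m4 : Measurable gs := by fun_prop
  have P := pointwise_bound γ b b₁ c₁ b' b₁' c' s hs lb lb₁ lc F G hFm hGm hF hG fs f0 g0 gs
    hfs hf0 hg0 hgs
  have t1 := meas_Tm γ b' b₁' c' m1 m3
  have t2 := meas_Tm (-γ) b' b₁' c' m1 m3
  have t3 := meas_Tm γ b' b₁' c' m2 m4
  have t4 := meas_Tm (-γ) b' b₁' c' m2 m4
  change nrm (fun p => ENNReal.ofReal (jb p.2 ^ s * jb (p.1 + p.2 ^ 2) ^ (-c₁)) * convR2 F G p) ≤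
    ENNReal.ofReal (2 ^ s * (C₁ + C₂)) * (nrm fs * nrm g0 + nrm f0 * nrm gs)
  refine (nrm_mono P).trans ?_
  rw [nrm_const_mul _ (by fun_prop), ENNReal.ofReal_mul h2s.le, mul_assoc]
  refine mul_le_mul' le_rfl ?_
  refine (nrm_add (by fun_prop) (by fun_prop)).trans ?_
  refine (add_le_add (nrm_add t1 t2) (nrm_add t3 t4)).trans ?_
  refine (add_le_add (add_le_add (H₁ _ _ m1 m3) (H₂ _ _ m1 m3))
    (add_le_add (H₁ _ _ m2 m4) (H₂ _ _ m2 m4))).trans (le_of_eq ?_)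
  rw [ENNReal.ofReal_add hC₁.le hC₂.le]
  ring
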